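/- arXiv:1110.6331 — 4 statements merged into one kernel-verified Lean document; each statement's English description precedes it below -/
import Mathlib

section
/- Let K be a number field with ring of integers 𝓞 and fix a nonzero α ∈ 𝓞. For odd β ∈ 𝓞 define the completed quadratic residue symbol |α/β| := μ_∞(α, β)·(α/β), where μ_∞(α, β) = ∏_v ε_v with the product over all real embeddings v of K and ε_v = −1 if v(α) < 0 and v(β) < 0, and ε_v = 1 otherwise. Then: (i) for all odd β, δ ∈ 𝓞 with β ≡ δ (mod 8α𝓞), one has |α/β| = |α/δ|; (ii) in particular, for all odd totally positive β, δ ∈ 𝓞 with β ≡ δ (mod 8α𝓞), one has (α/β) = (α/δ). -/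
set_option synthInstance.maxHeartbeats 1000000
set_option maxHeartbeats 2000000

open NumberField
open scoped Classical

noncomputable section

variable {K : Type*} [Field K] [NumberField K]

/-- The quadratic residue symbol `(α/𝔭)` modulo a prime ideal `𝔭`. -/
def legSym (𝔭 : Ideal (𝓞 K)) (α : 𝓞 K) : ℤ :=
  if Ideal.Quotient.mk 𝔭 α = 0 then 0
  else if IsSquare (Ideal.Quotient.mk 𝔭 α) then 1 else -1

/-- The quadratic residue symbol `(α/𝔟)` for an ideal `𝔟`, extended multiplicatively over
the prime factorization of `𝔟` (with multiplicity). -/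
def quadSym (𝔟 : Ideal (𝓞 K)) (α : 𝓞 K) : ℤ :=
  ((UniqueFactorizationMonoid.normalizedFactors 𝔟).map (fun 𝔭 => legSym 𝔭 α)).prod

/-- An element of `𝓞 K` is totally positive if it is positive under every real embedding. -/
def TotPos (α : 𝓞 K) : Prop := ∀ v : K →+* ℝ, 0 < v (α : K)

/-- `μ_∞(α,β) = ∏_v ε_v` over the real embeddings `v` of `K`, where `ε_v = -1` if
`v(α) < 0` and `v(β) < 0`, and `ε_v = 1` otherwise. -/
def muInf (α β : 𝓞 K) : ℤ :=
  ∏ᶠ v : K →+* ℝ, if v (α : K) < 0 ∧ v (β : K) < 0 then -1 else 1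

/-- `r` is a complete irredundant system of representatives of the cosets of `L` in `A`. -/
structure IsCosetSystem {V ι : Type*} [AddCommGroup V] (A L : AddSubgroup V) (r : ι → V) :
    Prop where
  mem : ∀ i, r i ∈ A
  existsUnique : ∀ x ∈ A, ∃! i, x - r i ∈ L

namespace IsCosetSystem

variable {V ι κ : Type*} [AddCommGroup V] {A L M : AddSubgroup V} {r : ι → V} {s : κ → V}

theorem eq_of_sub_mem (hr : IsCosetSystem A L r) {i j : ι} (h : r i - r j ∈ L) : i = j :=
  (hr.existsUnique (r i) (hr.mem i)).unique (by simp) h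

theorem sum_eq [Fintype ι] [Fintype κ] (hr : IsCosetSystem A L r) (hs : IsCosetSystem A L s)
    {f : V → ℂ} (hf : ∀ x ∈ A, ∀ l ∈ L, f (x + l) = f x) : ∑ i, f (r i) = ∑ j, f (s j) := by
  choose g hg _ using fun i => hs.existsUnique (r i) (hr.mem i)
  have hbij : Function.Bijective g := by
    refine ⟨fun i j hij => hr.eq_of_sub_mem ?_, fun k => ?_⟩
    · have h₁ := hg i
      have h₂ := hg j
      simp only [← hij] at h₁ h₂
      simpa using L.sub_mem h₁ h₂
    · obtain ⟨i, hi, -⟩ := hr.existsUnique (s k) (hs.mem k)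
      refine ⟨i, hs.eq_of_sub_mem ?_⟩
      have h₁ := hg i
      simp only at h₁ hi
      have := L.neg_mem (L.add_mem h₁ hi)
      rwa [show -(r i - s (g i) + (s k - r i)) = s (g i) - s k by abel] at this
  rw [← hbij.sum_comp]
  refine Finset.sum_congr rfl fun i _ => ?_
  have := hf (s (g i)) (hs.mem _) _ (hg i)
  simpa using this

theorem add_const (hr : IsCosetSystem A L r) {a : V} (ha : a ∈ A) :
    IsCosetSystem A L fun i => r i + a where
  mem i := A.add_mem (hr.mem i) ha
  existsUnique x hx := by
    simpa [sub_sub, add_comm] using hr.existsUnique (x - a) (A.sub_mem hx ha)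

theorem trans (hr : IsCosetSystem A M r) (hs : IsCosetSystem M L s) (hMA : M ≤ A) (hLM : L ≤ M) :
    IsCosetSystem A L fun p : ι × κ => r p.1 + s p.2 where
  mem p := A.add_mem (hr.mem _) (hMA (hs.mem _))
  existsUnique x hx := by
    obtain ⟨i, hi, hi'⟩ := hr.existsUnique x hx
    obtain ⟨j, hj, hj'⟩ := hs.existsUnique _ hi
    refine ⟨(i, j), by simpa [sub_sub] using hj, ?_⟩
    rintro ⟨i₂, j₂⟩ h
    have h' : x - r i₂ ∈ M := by
      have := M.add_mem (hLM h) (hs.mem j₂)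
      simpa [sub_add_eq_sub_sub] using this
    obtain rfl := hi' i₂ h'
    obtain rfl := hj' j₂ (by simpa [sub_sub] using h)
    rfl

/-- Representatives for a group of the form `B + C` where `B ∩ C = L`. -/
theorem add {B C : AddSubgroup V} (hr : IsCosetSystem B L r) (hs : IsCosetSystem C L s)
    (hBA : B ≤ A) (hCA : C ≤ A) (hA : ∀ x ∈ A, ∃ b ∈ B, ∃ c ∈ C, x = b + c)
    (hBC : ∀ x ∈ B, x ∈ C → x ∈ L) (hLC : L ≤ C) :
    IsCosetSystem A L fun p : ι × κ => r p.1 + s p.2 where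
  mem p := A.add_mem (hBA (hr.mem _)) (hCA (hs.mem _))
  existsUnique x hx := by
    obtain ⟨b, hb, c, hc, rfl⟩ := hA x hx
    obtain ⟨i, hi, hi'⟩ := hr.existsUnique b hb
    obtain ⟨j, hj, hj'⟩ := hs.existsUnique c hc
    refine ⟨(i, j), ?_, ?_⟩
    · simp only
      rw [show b + c - (r i + s j) = (b - r i) + (c - s j) by abel]
      exact L.add_mem hi hj
    · rintro ⟨i₂, j₂⟩ h
      simp only at h
      have hb₂ : b - r i₂ ∈ L := by
        refine hBC _ (B.sub_mem hb (hr.mem _)) ?_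
        rw [show b - r i₂ = (b + c - (r i₂ + s j₂)) + (s j₂ - c) by abel]
        exact C.add_mem (hLC h) (C.sub_mem (hs.mem _) hc)
      have hc₂ : c - s j₂ ∈ L := by
        rw [show c - s j₂ = (b + c - (r i₂ + s j₂)) - (b - r i₂) by abel]
        exact L.sub_mem h hb₂
      rw [hi' i₂ hb₂, hj' j₂ hc₂]

theorem exists_of_finite (A L : AddSubgroup V) [Finite (A ⧸ L.addSubgroupOf A)] :
    ∃ (n : ℕ) (r : Fin n → V), IsCosetSystem A L r := by
  obtain ⟨n, ⟨e⟩⟩ := Finite.exists_equiv_fin (A ⧸ L.addSubgroupOf A)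
  refine ⟨n, fun i => ((e.symm i).out : A), fun i => SetLike.coe_mem _, fun x hx => ?_⟩
  have key (i : Fin n) : x - ((e.symm i).out : A) ∈ L ↔ i = e (QuotientAddGroup.mk ⟨x, hx⟩) := by
    rw [← e.symm_apply_eq, ← QuotientAddGroup.out_eq' (e.symm i), QuotientAddGroup.eq,
      AddSubgroup.mem_addSubgroupOf]
    simp [sub_eq_neg_add]
  simp only [key]
  exact ⟨_, rfl, fun _ h => h⟩

theorem map {W : Type*} [AddCommGroup W] {B N : AddSubgroup W} (hr : IsCosetSystem A L r)
    (g : V →+ W) (hgA : ∀ x ∈ A, g x ∈ B) (hB : ∀ y ∈ B, ∃ x ∈ A, y - g x ∈ N)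
    (hN : ∀ x ∈ A, (g x ∈ N ↔ x ∈ L)) : IsCosetSystem B N fun i => g (r i) where
  mem i := hgA _ (hr.mem i)
  existsUnique y hy := by
    obtain ⟨x, hx, hxy⟩ := hB y hy
    have key (i : ι) : y - g (r i) ∈ N ↔ x - r i ∈ L := by
      rw [← hN _ (A.sub_mem hx (hr.mem i)), map_sub,
        show y - g (r i) = (y - g x) + (g x - g (r i)) by abel]
      exact N.add_mem_cancel_left hxy
    simpa only [key] using hr.existsUnique x hx

theorem restrict (hr : IsCosetSystem A L r) (hMA : M ≤ A) (hLM : L ≤ M) :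
    IsCosetSystem M L fun i : {i // r i ∈ M} => r i where
  mem i := i.2
  existsUnique x hx := by
    obtain ⟨i, hi, hi'⟩ := hr.existsUnique x (hMA hx)
    have hiM : r i ∈ M := by simpa using M.sub_mem hx (hLM hi)
    exact ⟨⟨i, hiM⟩, hi, fun j hj => Subtype.ext (hi' _ hj)⟩

/-- A function which transforms under translation by the lattice `L ⊆ A` through a pairing `b`
has its sum over `A / L₀` concentrated on the annihilator `P` of `L`. -/
theorem sum_eq_card_mul {ι₀ ι₁ ι₂ : Type*} [Fintype ι₀] [Fintype ι₁] [Fintype ι₂]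
    {A L P L₀ : AddSubgroup V} {r₀ : ι₀ → V} {r₁ : ι₁ → V} {r₂ : ι₂ → V}
    (h₀ : IsCosetSystem A L₀ r₀) (h₁ : IsCosetSystem L L₀ r₁) (h₂ : IsCosetSystem P L r₂)
    (hL₀ : L₀ ≤ L) (hLP : L ≤ P) (hPA : P ≤ A) (f : V → ℂ) (b : V → AddChar V ℂ)
    (hf : ∀ x ∈ A, ∀ l ∈ L, f (x + l) = f x * b x l)
    (hP : ∀ x ∈ A, (x ∈ P ↔ ∀ l ∈ L, b x l = 1))
    (hb : ∀ x ∈ A, ∀ l ∈ L₀, b x l = 1) :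
    ∑ i, f (r₀ i) = Fintype.card ι₁ * ∑ j, f (r₂ j) := by
  have horth (x : V) (hx : x ∈ A) :
      ∑ j, b x (r₁ j) = if x ∈ P then (Fintype.card ι₁ : ℂ) else 0 := by
    split_ifs with hxP
    · simp [(hP x hx).1 hxP _ (h₁.mem _)]
    · obtain ⟨l, hl, hne⟩ : ∃ l ∈ L, b x l ≠ 1 := by
        by_contra! h
        exact hxP ((hP x hx).2 h)
      have h := h₁.sum_eq (h₁.add_const hl) (f := b x)
        (fun y _ z hz => by rw [AddChar.map_add_eq_mul, hb x hx z hz, mul_one])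
      simp only [AddChar.map_add_eq_mul, ← Finset.sum_mul] at h
      by_contra h0
      exact hne (mul_left_cancel₀ h0 (by rw [mul_one]; exact h.symm))
  have hper (x) (hx : x ∈ A) (l) (hl : l ∈ L₀) : f (x + l) = f x := by
    rw [hf x hx l (hL₀ hl), hb x hx l hl, mul_one]
  have hcard : (Fintype.card ι₁ : ℂ) ≠ 0 := by
    obtain ⟨j, -⟩ := h₁.existsUnique 0 L.zero_mem
    exact_mod_cast (Fintype.card_pos_iff.2 ⟨j⟩).ne'
  have hsub := h₀.restrict hPA (hL₀.trans hLP)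
  have hsum : (Fintype.card ι₁ : ℂ) * ∑ i, f (r₀ i) =
      Fintype.card ι₁ * ∑ i : {i // r₀ i ∈ P}, f (r₀ i) := by
    calc (Fintype.card ι₁ : ℂ) * ∑ i, f (r₀ i)
        = ∑ j : ι₁, ∑ i, f (r₀ i + r₁ j) := by
          rw [Finset.sum_congr rfl fun j _ => (h₀.sum_eq (h₀.add_const
            (hPA (hLP (h₁.mem j)))) hper).symm]
          simp
      _ = ∑ i, f (r₀ i) * ∑ j, b (r₀ i) (r₁ j) := by
          rw [Finset.sum_comm]
          refine Finset.sum_congr rfl fun i _ => ?_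
          rw [Finset.mul_sum]
          exact Finset.sum_congr rfl fun j _ => hf _ (h₀.mem i) _ (h₁.mem j)
      _ = ∑ i, if r₀ i ∈ P then Fintype.card ι₁ * f (r₀ i) else 0 := by
          refine Finset.sum_congr rfl fun i _ => ?_
          rw [horth _ (h₀.mem i)]
          split_ifs <;> ring
      _ = _ := by
          rw [← Finset.sum_filter, Finset.mul_sum,
            Finset.sum_subtype (p := fun i => r₀ i ∈ P) _ (by simp)]
  rw [mul_left_cancel₀ hcard hsum,
    hsub.sum_eq (h₂.trans h₁ hLP hL₀) fun x hx l hl => hper x (hPA hx) l hl,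
    Fintype.sum_prod_type, Finset.mul_sum]
  refine Finset.sum_congr rfl fun i _ => ?_
  rw [Finset.sum_congr rfl fun j _ => (hf (r₂ i) (hPA (h₂.mem i)) (r₁ j) (h₁.mem j)).trans
    (by rw [(hP _ (hPA (h₂.mem i))).1 (h₂.mem i) _ (h₁.mem j), mul_one])]
  simp

end IsCosetSystem

theorem Complex.ofReal_mul_cpow_half {r : ℝ} (hr : 0 < r) {x : ℂ} (hx : x ≠ 0) :
    (r * x : ℂ) ^ (1 / 2 : ℂ) = Real.sqrt r * x ^ (1 / 2 : ℂ) := by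
  have hr' : (r : ℂ) ≠ 0 := by exact_mod_cast hr.ne'
  rw [cpow_def_of_ne_zero (mul_ne_zero hr' hx), cpow_def_of_ne_zero hx, log_ofReal_mul hr hx,
    add_mul, Complex.exp_add, Real.sqrt_eq_rpow, ofReal_cpow hr.le, cpow_def_of_ne_zero hr',
    ofReal_log hr.le]
  norm_num

open Filter Topology Complex in
theorem jacobiTheta_eq_sum_evenKernel (q : ℕ) (hq : 0 < q) {η : ℝ} (hη : 0 < η) :
    jacobiTheta (1 / (2 * q) + I * η) =
      ∑ k : Fin (2 * q), cexp (Real.pi * I * (k : ℂ) ^ 2 / (2 * q)) *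
        HurwitzZeta.evenKernel ((k / (2 * q) : ℝ) : UnitAddCircle) (4 * q ^ 2 * η) := by
  have : NeZero (2 * q) := ⟨by positivity⟩
  have hq' : (q : ℂ) ≠ 0 := by exact_mod_cast hq.ne'
  have him : 0 < ((1 / (2 * q) + I * η : ℂ)).im := by
    have : ((1 / (2 * q) : ℂ)).im = 0 := by
      rw [show (1 / (2 * q) : ℂ) = ((1 / (2 * q) : ℝ) : ℂ) by push_cast; rfl]
      exact ofReal_im _
    simpa [this] using hη
  have h₁ := hasSum_jacobiTheta₂_term 0 him
  rw [← jacobiTheta_eq_jacobiTheta₂] at h₁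
  have h₂ := ((Int.divModEquiv (2 * q)).trans (Equiv.prodComm _ _)).symm.hasSum_iff.2 h₁
  refine (HasSum.prod_fiberwise h₂ (g := fun k : Fin (2 * q) =>
    cexp (Real.pi * I * (k : ℂ) ^ 2 / (2 * q)) *
      HurwitzZeta.evenKernel ((k / (2 * q) : ℝ) : UnitAddCircle) (4 * q ^ 2 * η))
    fun k => ?_).unique (hasSum_fintype _)
  have h₃ := HurwitzZeta.hasSum_int_evenKernel (k / (2 * q)) (t := 4 * q ^ 2 * η) (by positivity)
  have h₄ := (Complex.hasSum_ofReal.2 h₃).mul_left (cexp (Real.pi * I * (k : ℂ) ^ 2 / (2 * q)))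
  refine h₄.congr_fun fun n => ?_
  simp only [Function.comp_apply, Equiv.symm_trans_apply, Equiv.prodComm_symm,
    Equiv.prodComm_apply, Prod.swap_prod_mk, Int.divModEquiv_symm_apply, jacobiTheta₂_term]
  push_cast
  rw [← Complex.exp_add]
  refine Complex.exp_eq_exp_iff_exists_int.2 ⟨q * n ^ 2 + n * k, ?_⟩
  push_cast
  have : I ^ 2 = -1 := I_sq
  field_simp
  ring_nf
  simp only [this]
  ring

open Filter Topology Complex in
theorem sum_exp_sq_eq_sqrt_mul (q : ℕ) (hq : 0 < q) :
    ∑ k : Fin (2 * q), cexp (Real.pi * I * (k : ℂ) ^ 2 / (2 * q)) =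
      Real.sqrt (2 * q) * cexp (Real.pi * I / 4) := by
  have hq' : (q : ℂ) ≠ 0 := by exact_mod_cast hq.ne'
  have hqr : (0 : ℝ) < q := by exact_mod_cast hq
  have hτ : Tendsto (fun η : ℝ => (1 / (2 * q) + I * η : ℂ)) (𝓝[>] 0) (𝓝 (1 / (2 * q))) := by
    have : Continuous fun η : ℝ => (1 / (2 * q) + I * η : ℂ) := by fun_prop
    simpa using (this.tendsto 0).mono_left nhdsWithin_le_nhds
  have hinv : Tendsto (fun η : ℝ => 1 / (4 * q ^ 2 * η)) (𝓝[>] 0) atTop := by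
    have : Tendsto (fun η : ℝ => (1 / (4 * q ^ 2)) * η⁻¹) (𝓝[>] 0) atTop :=
      tendsto_inv_nhdsGT_zero.const_mul_atTop (by positivity)
    refine this.congr fun η => ?_
    field_simp
  have hcos (a : UnitAddCircle) : Tendsto (HurwitzZeta.cosKernel a) atTop (𝓝 1) := by
    obtain ⟨p, hp, h⟩ := HurwitzZeta.isBigO_atTop_cosKernel_sub a
    have h0 : Tendsto (fun x : ℝ => Real.exp (-p * x)) atTop (𝓝 0) :=
      Real.tendsto_exp_atBot.comp (tendsto_id.const_mul_atTop_of_neg (neg_lt_zero.2 hp))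
    simpa using (h.trans_tendsto h0).add_const 1
  have hA : Tendsto (fun η : ℝ => (2 * q * Real.sqrt η : ℂ) * jacobiTheta (1 / (2 * q) + I * η))
      (𝓝[>] 0) (𝓝 (∑ k : Fin (2 * q), cexp (Real.pi * I * (k : ℂ) ^ 2 / (2 * q)))) := by
    have h : Tendsto (fun η : ℝ => ∑ k : Fin (2 * q),
        cexp (Real.pi * I * (k : ℂ) ^ 2 / (2 * q)) *
          HurwitzZeta.cosKernel ((k / (2 * q) : ℝ) : UnitAddCircle) (1 / (4 * q ^ 2 * η)))
        (𝓝[>] 0) (𝓝 (∑ k : Fin (2 * q), cexp (Real.pi * I * (k : ℂ) ^ 2 / (2 * q)) *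
          ((1 : ℝ) : ℂ))) :=
      tendsto_finsetSum _ fun k _ => ((continuous_ofReal.tendsto _).comp
        ((hcos _).comp hinv)).const_mul _
    simp only [ofReal_one, mul_one] at h
    refine h.congr' ?_
    filter_upwards [self_mem_nhdsWithin] with η hη
    have hη : 0 < η := hη
    rw [jacobiTheta_eq_sum_evenKernel q hq hη, Finset.mul_sum]
    refine Finset.sum_congr rfl fun k _ => ?_
    rw [HurwitzZeta.evenKernel_functional_equation, ← Real.sqrt_eq_rpow,
      show (4 * q ^ 2 * η : ℝ) = (2 * q) ^ 2 * η by ring, Real.sqrt_mul (by positivity),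
      Real.sqrt_sq (by positivity)]
    have : (Real.sqrt η : ℂ) ≠ 0 := by exact_mod_cast (Real.sqrt_pos.2 hη).ne'
    push_cast
    field_simp
  have hB : Tendsto (fun η : ℝ => (2 * q * Real.sqrt η : ℂ) * jacobiTheta (1 / (2 * q) + I * η))
      (𝓝[>] 0) (𝓝 (2 * q * (1 / (-I * (1 / (2 * q))) ^ (1 / 2 : ℂ) *
        (1 / (2 * q / (1 / (2 * q))) ^ (1 / 2 : ℂ) * 1)))) := by
    have hlim : Tendsto (fun η : ℝ => jacobiTheta (I / (4 * q ^ 2 * η) - 1 / (2 * q)))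
        (𝓝[>] 0) (𝓝 1) := by
      have h0 : Tendsto (fun η : ℝ => Real.exp (-Real.pi * (1 / (4 * q ^ 2 * η)))) (𝓝[>] 0)
          (𝓝 0) :=
        Real.tendsto_exp_atBot.comp
          (hinv.const_mul_atTop_of_neg (neg_lt_zero.2 Real.pi_pos))
      have him (η : ℝ) : (I / (4 * q ^ 2 * η) - 1 / (2 * q) : ℂ).im = 1 / (4 * q ^ 2 * η) := by
        rw [show (I / (4 * q ^ 2 * η) - 1 / (2 * q) : ℂ) =
          ((-(1 / (2 * q)) : ℝ) : ℂ) + ((1 / (4 * q ^ 2 * η) : ℝ) : ℂ) * I by push_cast; ring]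
        rw [add_im, ofReal_im, im_ofReal_mul, I_im]
        ring
      have hcomap : Tendsto (fun η : ℝ => (I / (4 * q ^ 2 * η) - 1 / (2 * q) : ℂ)) (𝓝[>] 0)
          (comap im atTop) := tendsto_comap_iff.2 (hinv.congr fun η => (him η).symm)
      have h1 := isBigO_at_im_infty_jacobiTheta_sub_one.comp_tendsto hcomap
      have h2 := h1.trans_tendsto (h0.congr fun η => by simp only [Function.comp, him])
      simpa using h2.add_const 1
    have hc1 : Tendsto (fun η : ℝ => 1 / (-I * (1 / (2 * q) + I * η)) ^ (1 / 2 : ℂ)) (𝓝[>] 0)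
        (𝓝 (1 / (-I * (1 / (2 * q))) ^ (1 / 2 : ℂ))) := by
      refine Tendsto.div tendsto_const_nhds ((hτ.const_mul (-I)).cpow tendsto_const_nhds ?_) ?_
      · right
        rw [show -I * (1 / (2 * q)) = ((-(1 / (2 * q)) : ℝ) : ℂ) * I by push_cast; ring]
        simp [hq.ne']
      · simp [cpow_eq_zero_iff, hq']
    have hc2 : Tendsto (fun η : ℝ => 1 / (2 * q / (1 / (2 * q) + I * η)) ^ (1 / 2 : ℂ)) (𝓝[>] 0)
        (𝓝 (1 / (2 * q / (1 / (2 * q))) ^ (1 / 2 : ℂ))) := by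
      refine Tendsto.div tendsto_const_nhds ((Tendsto.div tendsto_const_nhds hτ ?_).cpow
        tendsto_const_nhds ?_) ?_
      · simpa using hq'
      · left
        rw [show (2 * q / (1 / (2 * q)) : ℂ) = ((4 * q ^ 2 : ℝ) : ℂ) by
          push_cast; field_simp; norm_num, ofReal_re]
        positivity
      · simp [cpow_eq_zero_iff, hq']
    refine ((hc1.mul (hc2.mul hlim)).const_mul (2 * q : ℂ)).congr' ?_
    filter_upwards [self_mem_nhdsWithin] with η hη
    have hη : 0 < η := hη
    set τ : ℂ := 1 / (2 * q) + I * η with hτdef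
    have hτ0 : τ ≠ 0 := by
      intro h
      have := congrArg re h
      rw [hτdef, show (1 / (2 * q) + I * η : ℂ) = ((1 / (2 * q) : ℝ) : ℂ) + I * η by
        push_cast; rfl] at this
      simp [hq.ne'] at this
    have hη0 : (η : ℂ) ≠ 0 := by exact_mod_cast hη.ne'
    have hshift (n : ℕ) (z : ℂ) : jacobiTheta (2 * n + z) = jacobiTheta z := by
      induction n with
      | zero => simp
      | succ n ih =>
        rw [show (2 * ((n + 1 : ℕ) : ℂ) + z) = 2 + (2 * n + z) by push_cast; ring,
          jacobiTheta_two_add, ih]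
    have hfe (z : ℂ) : jacobiTheta z = 1 / (-I * z) ^ (1 / 2 : ℂ) * jacobiTheta (-1 / z) := by
      simpa [jacobiTheta_eq_jacobiTheta₂] using jacobiTheta₂_functional_equation 0 z
    have hσ : 2 * q + -1 / τ = 2 * q * I * η / τ := by
      have h1 : 2 * q * τ = 1 + 2 * q * I * η := by
        rw [hτdef]
        field_simp
      field_simp
      linear_combination h1
    have hσ' : -1 / (2 * q * I * η / τ) = I / (4 * q ^ 2 * η) - 1 / (2 * q) := by
      have h2 : -1 / (2 * q * I * η / τ) = τ * I / (2 * q * η) := by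
        field_simp
        rw [I_sq]
      rw [h2, hτdef]
      field_simp
      ring_nf
      simp only [I_sq]
      ring
    have hσ'' : -I * (2 * q * I * η / τ) = η * (2 * q / τ) := by
      ring_nf
      simp only [I_sq]
      ring
    rw [hfe τ, ← hshift q (-1 / τ), hσ, hfe (2 * q * I * η / τ), hσ', hσ'',
      ofReal_mul_cpow_half hη (div_ne_zero (by simpa using hq') hτ0)]
    have : (Real.sqrt η : ℂ) ≠ 0 := by exact_mod_cast (Real.sqrt_pos.2 hη).ne'
    field_simp
  rw [tendsto_nhds_unique hA hB,
    show (2 * q / (1 / (2 * q)) : ℂ) = ((2 * q) ^ 2 : ℝ) * 1 by push_cast; field_simp,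
    show (-I * (1 / (2 * q)) : ℂ) = ((2 * q)⁻¹ : ℝ) * -I by push_cast; ring,
    ofReal_mul_cpow_half (by positivity) one_ne_zero,
    ofReal_mul_cpow_half (by positivity) (neg_ne_zero.2 I_ne_zero),
    Real.sqrt_sq (by positivity), one_cpow, cpow_def_of_ne_zero (neg_ne_zero.2 I_ne_zero),
    log_neg_I, show (-(Real.pi / 2) * I * (1 / 2) : ℂ) = -(Real.pi * I / 4) by ring,
    Complex.exp_neg, Real.sqrt_inv]
  have : (Real.sqrt (2 * q) : ℂ) ≠ 0 := by
    exact_mod_cast (Real.sqrt_pos.2 (by positivity)).ne'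
  push_cast
  field_simp

/-- The additive character `x ↦ exp (2πix)` of `ℚ`. -/
def ratExp : AddChar ℚ ℂ where
  toFun x := Complex.exp (2 * Real.pi * Complex.I * x)
  map_zero_eq_one' := by simp
  map_add_eq_mul' x y := by rw [← Complex.exp_add]; push_cast; ring_nf

theorem ratExp_apply (x : ℚ) : ratExp x = Complex.exp (2 * Real.pi * Complex.I * x) := rfl

theorem ratExp_eq_one_iff {x : ℚ} : ratExp x = 1 ↔ ∃ n : ℤ, x = n := by
  rw [ratExp_apply, Complex.exp_eq_one_iff]
  refine exists_congr fun n => ?_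
  rw [mul_comm, mul_left_inj' Complex.two_pi_I_ne_zero]
  norm_cast

/-- The primitive eighth root of unity `exp (πi/4)`. -/
def zetaEight : ℂ := Complex.exp (Real.pi * Complex.I / 4)

theorem zetaEight_ne_zero : zetaEight ≠ 0 := Complex.exp_ne_zero _

theorem zetaEight_pow_four : zetaEight ^ 4 = -1 := by
  rw [zetaEight, ← Complex.exp_nat_mul, ← Complex.exp_pi_mul_I]
  congr 1
  push_cast
  ring

theorem sum_ratExp_sq {a : ℤ} (ha : a ≠ 0) :
    ∑ k : Fin (2 * a.natAbs), ratExp ((k : ℚ) ^ 2 / (4 * a)) =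
      Real.sqrt (2 * a.natAbs) * zetaEight ^ (SignType.sign a : ℤ) := by
  have h := sum_exp_sq_eq_sqrt_mul a.natAbs (Int.natAbs_pos.2 ha)
  rcases ha.lt_or_gt with hneg | hpos
  · obtain ⟨n, rfl⟩ : ∃ n : ℕ, a = -n := ⟨a.natAbs, by omega⟩
    simp only [Int.natAbs_neg, Int.natAbs_natCast] at h ⊢
    have h' := congrArg (starRingEnd ℂ) h
    rw [map_sum, map_mul, Complex.conj_ofReal, ← Complex.exp_conj] at h'
    rw [sign_neg hneg]
    simp only [SignType.coe_neg_one, zpow_neg_one]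
    rw [zetaEight, ← Complex.exp_neg]
    convert h' using 2 with k
    · rw [ratExp_apply, ← Complex.exp_conj]
      simp only [map_mul, map_div₀, map_pow, Complex.conj_I, Complex.conj_ofReal, map_natCast,
        map_ofNat]
      congr 1
      push_cast
      rcases eq_or_ne (n : ℂ) 0 with h0 | h0
      · simp [h0]
      · field_simp
        ring
    · simp only [map_mul, map_div₀, Complex.conj_I, Complex.conj_ofReal, map_ofNat]
      ring_nf
  · obtain ⟨n, rfl⟩ : ∃ n : ℕ, a = n := ⟨a.natAbs, by omega⟩
    simp only [Int.natAbs_natCast] at h ⊢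
    rw [sign_pos hpos]
    simp only [SignType.coe_one, zpow_one]
    rw [zetaEight, ← h]
    refine Finset.sum_congr rfl fun k _ => ?_
    rw [ratExp_apply]
    congr 1
    push_cast
    rcases eq_or_ne (n : ℂ) 0 with h0 | h0
    · simp [h0]
    · field_simp
      ring

/-- Real embeddings of `K` correspond to its real places. -/
def realPlaceEquiv (K : Type*) [Field K] [NumberField K] :
    {w : InfinitePlace K // w.IsReal} ≃ (K →+* ℝ) :=
  Equiv.ofBijective (fun w => InfinitePlace.embedding_of_isReal w.2) <| by
    refine ⟨fun w₁ w₂ h => Subtype.ext (InfinitePlace.embedding_injective K ?_), fun v => ?_⟩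
    · ext x
      have := DFunLike.congr_fun h x
      simp only at this
      rw [← InfinitePlace.embedding_of_isReal_apply w₁.2, this,
        InfinitePlace.embedding_of_isReal_apply]
    · have hreal : ComplexEmbedding.IsReal (Complex.ofRealHom.comp v) := by
        ext x
        simp [ComplexEmbedding.conjugate_coe_eq]
      refine ⟨⟨InfinitePlace.mk (Complex.ofRealHom.comp v), InfinitePlace.isReal_mk_iff.2 hreal⟩, ?_⟩
      ext x
      rw [← Complex.ofReal_inj, InfinitePlace.embedding_of_isReal_apply,
        InfinitePlace.embedding_mk_eq_of_isReal hreal]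
      rfl

theorem realPlaceEquiv_apply (w : {w : InfinitePlace K // w.IsReal}) (x : K) :
    (realPlaceEquiv K w x : ℂ) = w.1.embedding x :=
  InfinitePlace.embedding_of_isReal_apply w.2 x

theorem trace_eq_sum_ringHom (x : K) :
    ((Algebra.trace ℚ K x : ℚ) : ℂ) = ∑ σ : K →+* ℂ, σ x := by
  have := trace_eq_sum_embeddings ℂ (K := ℚ) (x := x)
  rw [eq_ratCast] at this
  rw [this]
  exact Fintype.sum_equiv (RingHom.equivRatAlgHom (R := K) (S := ℂ)).symm _ _ fun σ => rfl

/-- A subspace on which the form `x ↦ Tr (ω x²)` is positive definite has dimension at most the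
number of places which are not real places where `ω` is negative. -/
theorem card_le_of_trace_pos (ω : K) {ι : Type*} [Fintype ι] (v : ι → K) (a : ι → ℚ)
    (ha : ∀ i, 0 < a i)
    (hv : ∀ i j, Algebra.trace ℚ K (ω * v i * v j) = if i = j then a i else 0) :
    Fintype.card ι + Fintype.card {φ : K →+* ℝ // φ ω < 0} ≤ Fintype.card (InfinitePlace K) := by
  set Q : InfinitePlace K → Prop := fun w => w.IsReal ∧ (w.embedding ω).re < 0 with hQ
  have hcard : Fintype.card {φ : K →+* ℝ // φ ω < 0} = Fintype.card {w // Q w} := by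
    refine (Fintype.card_congr ?_).symm
    refine (Equiv.subtypeSubtypeEquivSubtypeInter _ _).symm.trans
      ((realPlaceEquiv K).subtypeEquiv fun w => ?_)
    rw [← realPlaceEquiv_apply, Complex.ofReal_re]
  rw [hcard]
  by_contra! hlt
  have hlt' : Fintype.card {w // ¬ Q w} < Fintype.card ι := by
    rw [Fintype.card_subtype_compl]
    have := Fintype.card_subtype_le Q
    omega
  choose s hs using fun w : InfinitePlace K =>
    IsAlgClosed.exists_pow_nat_eq (w.embedding ω) (n := 2) two_pos
  let T : (ι → ℝ) →ₗ[ℝ] ({w // ¬ Q w} → ℝ) :=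
    LinearMap.pi fun w => ∑ i, (s w * w.1.embedding (v i)).re • LinearMap.proj i
  have hT (t) (w) : T t w = (s w * ∑ i, t i * w.1.embedding (v i)).re := by
    simp only [T, LinearMap.pi_apply, LinearMap.sum_apply, LinearMap.smul_apply,
      LinearMap.proj_apply, Finset.mul_sum, Complex.re_sum, smul_eq_mul]
    refine Finset.sum_congr rfl fun i _ => ?_
    rw [mul_left_comm, Complex.re_ofReal_mul, mul_comm]
  obtain ⟨t, ht, ht0⟩ := (Submodule.ne_bot_iff _).1
    (LinearMap.ker_ne_bot_of_finrank_lt (f := T) (by simpa using hlt'))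
  have hplace (w : InfinitePlace K) :
      (w.embedding ω * (∑ i, t i * w.embedding (v i)) ^ 2).re ≤ 0 := by
    by_cases hw : Q w
    · obtain ⟨hr, hneg⟩ := hw
      have hx : (∑ i, t i * w.embedding (v i)) ^ 2 =
          (((∑ i, t i * InfinitePlace.embedding_of_isReal hr (v i)) ^ 2 : ℝ) : ℂ) := by
        push_cast
        simp only [InfinitePlace.embedding_of_isReal_apply]
      rw [hx, mul_comm, Complex.re_ofReal_mul]
      exact mul_nonpos_of_nonneg_of_nonpos (sq_nonneg _) hneg.le
    · have h := hT t ⟨w, hw⟩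
      rw [LinearMap.mem_ker.1 ht, Pi.zero_apply] at h
      rw [← hs w, ← mul_pow, sq, Complex.mul_re, ← h]
      nlinarith [sq_nonneg (s w * ∑ i, t i * w.embedding (v i)).im]
  have hall (σ : K →+* ℂ) : (σ ω * (∑ i, t i * σ (v i)) ^ 2).re ≤ 0 := by
    rcases InfinitePlace.mk_eq_iff.1 (InfinitePlace.mk_embedding (InfinitePlace.mk σ)) with h | h
    · simpa only [h] using hplace (InfinitePlace.mk σ)
    · rw [← h]
      refine le_of_eq_of_le ?_ (hplace (InfinitePlace.mk σ))
      rw [← Complex.conj_re (_ * _)]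
      simp [ComplexEmbedding.conjugate_coe_eq]
  have hsum : ∑ σ : K →+* ℂ, σ ω * (∑ i, t i * σ (v i)) ^ 2 = ((∑ i, t i ^ 2 * a i : ℝ) : ℂ) := by
    calc ∑ σ : K →+* ℂ, σ ω * (∑ i, t i * σ (v i)) ^ 2
        = ∑ σ : K →+* ℂ, ∑ i, ∑ j, (t i : ℂ) * t j * σ (ω * v i * v j) := by
          refine Finset.sum_congr rfl fun σ _ => ?_
          rw [sq, Finset.sum_mul_sum, Finset.mul_sum]
          refine Finset.sum_congr rfl fun i _ => ?_
          rw [Finset.mul_sum]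
          refine Finset.sum_congr rfl fun j _ => ?_
          rw [map_mul, map_mul]
          ring
      _ = ∑ i, ∑ j, (t i : ℂ) * t j * (Algebra.trace ℚ K (ω * v i * v j) : ℚ) := by
          simp only [trace_eq_sum_ringHom, Finset.mul_sum]
          rw [Finset.sum_comm]
          exact Finset.sum_congr rfl fun i _ => Finset.sum_comm
      _ = _ := by
          push_cast
          refine Finset.sum_congr rfl fun i _ => ?_
          simp only [hv, apply_ite (Rat.cast : ℚ → ℂ), Rat.cast_zero, mul_ite, mul_zero, Finset.sum_ite_eq,
            Finset.mem_univ, if_true]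
          ring
  have hle : ∑ i, t i ^ 2 * (a i : ℝ) ≤ 0 := by
    rw [← Complex.ofReal_re (∑ i, t i ^ 2 * (a i : ℝ)), ← hsum, Complex.re_sum]
    exact Finset.sum_nonpos fun σ _ => hall σ
  obtain ⟨i, hi⟩ := Function.ne_iff.1 ht0
  have hpos : 0 < ∑ i, t i ^ 2 * (a i : ℝ) :=
    Finset.sum_pos' (fun i _ => mul_nonneg (sq_nonneg _) (by exact_mod_cast (ha i).le))
      ⟨i, Finset.mem_univ _, mul_pos (by simpa using sq_pos_of_ne_zero hi)
        (by exact_mod_cast ha i)⟩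
  exact hpos.not_ge hle

theorem sum_sign_eq {ι : Type*} [Fintype ι] (a : ι → ℝ) (ha : ∀ i, a i ≠ 0) :
    ∑ i, (SignType.sign (a i) : ℤ) = Fintype.card {i // 0 < a i} - Fintype.card {i // a i < 0} := by
  rw [Fintype.card_subtype, Fintype.card_subtype, Finset.card_filter, Finset.card_filter]
  push_cast
  rw [← Finset.sum_sub_distrib]
  refine Finset.sum_congr rfl fun i _ => ?_
  rcases (ha i).lt_or_gt with h | h
  · simp [h, h.not_gt]
  · simp [h, h.not_gt]

theorem card_pos_add_card_neg {ι : Type*} [Fintype ι] (a : ι → ℝ) (ha : ∀ i, a i ≠ 0) :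
    Fintype.card {i // 0 < a i} + Fintype.card {i // a i < 0} = Fintype.card ι := by
  rw [← Fintype.card_subtype_or_disjoint _ _ ?_]
  · exact Fintype.card_congr (Equiv.subtypeUnivEquiv fun i => (ha i).lt_or_gt.symm)
  · rw [Pi.disjoint_iff]
    intro i
    rw [Prop.disjoint_iff]
    simpa [or_iff_not_imp_left] using fun h : 0 < a i => h.le

/-- The signature of the rational quadratic form `x ↦ Tr (ω x²)`. -/
theorem sum_sign_trace_form (ω : K) (hω : ω ≠ 0) {ι : Type*} [Fintype ι]
    (hι : Fintype.card ι = Module.finrank ℚ K) (v : ι → K) (a : ι → ℚ) (ha : ∀ i, a i ≠ 0)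
    (hv : ∀ i j, Algebra.trace ℚ K (ω * v i * v j) = if i = j then a i else 0) :
    ∑ i, (SignType.sign (a i) : ℤ) = ∑ φ : K →+* ℝ, (SignType.sign (φ ω) : ℤ) := by
  have hφ (φ : K →+* ℝ) : φ ω ≠ 0 := by simpa using hω
  have hpos := card_le_of_trace_pos ω (fun i : {i // 0 < a i} => v i) (fun i => a i)
    (fun i => i.2) fun i j => by simp [hv, Subtype.ext_iff]
  have hneg := card_le_of_trace_pos (-ω) (fun i : {i // a i < 0} => v i) (fun i => -a i)
    (fun i => neg_pos.2 i.2) fun i j => by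
      rw [neg_mul, neg_mul, map_neg, hv]
      split_ifs <;> simp_all [Subtype.ext_iff]
  simp only [map_neg, neg_lt_zero] at hneg
  have hsign (i : ι) : SignType.sign (a i) = SignType.sign (a i : ℝ) := by
    rcases (ha i).lt_or_gt with h | h
    · rw [sign_neg h, sign_neg (by exact_mod_cast h)]
    · rw [sign_pos h, sign_pos (by exact_mod_cast h)]
  have h₁ := card_pos_add_card_neg (fun i => (a i : ℝ)) fun i => by exact_mod_cast ha i
  have h₂ := card_pos_add_card_neg (fun φ : K →+* ℝ => φ ω) hφ
  have h₃ := InfinitePlace.card_add_two_mul_card_eq_rank K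
  have h₄ := InfinitePlace.card_eq_nrRealPlaces_add_nrComplexPlaces K
  have h₅ : Fintype.card (K →+* ℝ) = InfinitePlace.nrRealPlaces K :=
    (Fintype.card_congr (realPlaceEquiv K)).symm
  simp only [hsign]
  rw [sum_sign_eq _ fun i => by exact_mod_cast ha i, sum_sign_eq _ hφ]
  simp only [Rat.cast_pos, Rat.cast_lt_zero] at h₁ ⊢
  omega

/-- The additive character `x ↦ exp (2πi Tr (θx))` of `K`. -/
def traceChar (θ : K) : AddChar K ℂ :=
  ratExp.compAddMonoidHom
    ((Algebra.trace ℚ K).toAddMonoidHom.comp (AddMonoidHom.mulLeft θ))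

theorem traceChar_apply (θ x : K) : traceChar θ x = ratExp (Algebra.trace ℚ K (θ * x)) := rfl

theorem traceChar_congr {θ θ' x x' : K} (h : θ * x = θ' * x') :
    traceChar θ x = traceChar θ' x' := by
  rw [traceChar_apply, traceChar_apply, h]

/-- The ring of integers as an additive subgroup of `K`. -/
def intSub (K : Type*) [Field K] [NumberField K] : AddSubgroup K :=
  (algebraMap (𝓞 K) K).toAddMonoidHom.range

theorem mem_intSub {x : K} : x ∈ intSub K ↔ ∃ y : 𝓞 K, (y : K) = x := Iff.rfl

theorem coe_mem_intSub (y : 𝓞 K) : (y : K) ∈ intSub K := ⟨y, rfl⟩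

theorem mul_mem_intSub {x y : K} (hx : x ∈ intSub K) (hy : y ∈ intSub K) : x * y ∈ intSub K := by
  obtain ⟨x, rfl⟩ := hx
  obtain ⟨y, rfl⟩ := hy
  exact ⟨x * y, map_mul (algebraMap (𝓞 K) K) x y⟩

/-- The dual of the ring of integers for the pairing `(x, y) ↦ exp (2πi Tr (θxy))`. -/
def dualSub (θ : K) : AddSubgroup K where
  carrier := {x | ∀ y : 𝓞 K, traceChar θ (x * y) = 1}
  zero_mem' y := by simp
  add_mem' {a b} ha hb y := by rw [add_mul, AddChar.map_add_eq_mul, ha, hb, one_mul]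
  neg_mem' {a} ha y := by rw [neg_mul, AddChar.map_neg_eq_inv, ha, inv_one]

theorem mul_mem_dualSub {θ x y : K} (hx : x ∈ dualSub θ) (hy : y ∈ intSub K) :
    x * y ∈ dualSub θ := by
  obtain ⟨y, rfl⟩ := hy
  intro z
  rw [mul_assoc]
  exact hx (y * z)

theorem traceChar_add_sq (ω x y : K) :
    traceChar ω ((x + y) ^ 2) =
      traceChar ω (x ^ 2) * traceChar (2 * ω * x) y * traceChar ω (y ^ 2) := by
  rw [traceChar_congr (show 2 * ω * x * y = ω * (2 * x * y) by ring), ← AddChar.map_add_eq_mul,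
    ← AddChar.map_add_eq_mul]
  congr 1
  ring

theorem exists_orthogonal_integral_basis (ω : K) (hω : ω ≠ 0) :
    ∃ (v : Module.Basis (Fin (Module.finrank ℚ K)) ℚ K) (a : Fin (Module.finrank ℚ K) → ℚ),
      (∀ i, v i ∈ intSub K) ∧ (∀ i, a i ≠ 0) ∧
        ∀ i j, Algebra.trace ℚ K (ω * v i * v j) = if i = j then a i else 0 := by
  set B : LinearMap.BilinForm ℚ K := (Algebra.traceForm ℚ K).compLeft (LinearMap.mulLeft ℚ ω)
    with hB
  have hBa (x y : K) : B x y = Algebra.trace ℚ K (ω * x * y) := rfl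
  obtain ⟨u, hu⟩ := LinearMap.BilinForm.exists_orthogonal_basis (B := B)
    ⟨fun x y => by simp only [hBa, RingHom.id_apply]; congr 1; ring⟩
  obtain ⟨y, hy0, hy⟩ := exists_integral_multiples ℤ ℚ (Finset.univ.image u)
  have hyQ : (y : ℚ) ≠ 0 := by exact_mod_cast hy0
  let v := u.isUnitSMul (w := fun _ => (y : ℚ)) fun _ => hyQ.isUnit
  have hv (i) : v i = (y : ℚ) • u i := u.isUnitSMul_apply _ i
  have horth (i j) (hij : i ≠ j) : Algebra.trace ℚ K (ω * v i * v j) = 0 := by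
    have : B (u i) (u j) = 0 := hu hij
    rw [← hBa, hv, hv, map_smul, LinearMap.map_smul₂, this, smul_zero, smul_zero]
  refine ⟨v, fun i => Algebra.trace ℚ K (ω * v i * v i), fun i => ?_, fun i h => ?_, fun i j => ?_⟩
  · rw [hv]
    have := hy (u i) (by simp)
    refine ⟨⟨y • u i, this⟩, ?_⟩
    change y • u i = _
    rw [Int.cast_smul_eq_zsmul]
  · have hz : ω * v i = 0 := by
      refine (traceForm_nondegenerate ℚ K).1 _ fun x => ?_
      rw [← v.sum_repr x, map_sum]
      refine Finset.sum_eq_zero fun j _ => ?_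
      rw [map_smul, Algebra.traceForm_apply]
      rcases eq_or_ne i j with rfl | hij
      · exact (congrArg _ h).trans (smul_zero _)
      · rw [horth i j hij, smul_zero]
    exact mul_ne_zero hω (v.ne_zero i) hz
  · split_ifs with hij
    · rw [hij]
    · exact horth i j hij

theorem existsUnique_fin_sub_div {z : ℤ} (hz : z ≠ 0) (n : ℤ) :
    ∃! k : Fin (2 * z.natAbs), ∃ m : ℤ, (n : ℚ) / (2 * z) - k / (2 * z) = m := by
  have hzQ : (z : ℚ) ≠ 0 := by exact_mod_cast hz
  have key (k : ℕ) : (∃ m : ℤ, (n : ℚ) / (2 * z) - k / (2 * z) = m) ↔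
      (2 * z.natAbs : ℤ) ∣ n - k := by
    have : (2 * z.natAbs : ℤ) ∣ n - k ↔ 2 * z ∣ n - k := by
      rcases Int.natAbs_eq z with h | h
      · rw [← h]
      · conv_rhs => rw [h]
        rw [mul_neg, neg_dvd]
    rw [this]
    refine exists_congr fun m => ?_
    rw [← sub_div, div_eq_iff (by positivity)]
    norm_cast
    rw [mul_comm]
  have hpos : 0 < 2 * (z.natAbs : ℤ) := by omega
  simp only [key]
  refine ⟨⟨(n % (2 * z.natAbs)).toNat, ?_⟩, ?_, fun k hk => Fin.ext ?_⟩
  · have := Int.emod_lt_of_pos n hpos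
    have := Int.emod_nonneg n hpos.ne'
    omega
  · simp only [Int.toNat_of_nonneg (Int.emod_nonneg n hpos.ne')]
    exact Int.dvd_self_sub_emod
  · have h₁ : (k : ℤ) < 2 * z.natAbs := by exact_mod_cast k.2
    have h₂ : n % (2 * z.natAbs) = k :=
      (Int.emod_eq_emod_iff_emod_sub_eq_zero.2 (Int.emod_eq_zero_of_dvd hk)).trans
        (Int.emod_eq_of_lt (by positivity) h₁)
    simp only [h₂, Int.toNat_natCast]

theorem ratExp_sum {ι : Type*} (s : Finset ι) (f : ι → ℚ) :
    ratExp (∑ i ∈ s, f i) = ∏ i ∈ s, ratExp (f i) := by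
  induction s using Finset.induction_on with
  | empty => simp
  | insert i s hi ih => rw [Finset.sum_insert hi, Finset.prod_insert hi, AddChar.map_add_eq_mul, ih]

/-- Milgram's formula for the trace form `x ↦ Tr (ωx²)`, up to a positive factor. -/
theorem exists_sum_traceChar_sq_eq (ω : K) (hω : ω ≠ 0) (hωint : ∀ y : 𝓞 K, traceChar ω y = 1)
    {ι : Type*} [Fintype ι] {r : ι → K} (hr : IsCosetSystem (dualSub (2 * ω)) (intSub K) r) :
    ∃ t : ℝ, 0 < t ∧ ∑ i, traceChar ω (r i ^ 2) =
      t * zetaEight ^ (∑ φ : K →+* ℝ, (SignType.sign (φ ω) : ℤ)) := by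
  obtain ⟨v, a, hv, ha, horth⟩ := exists_orthogonal_integral_basis ω hω
  have htr (x y : K) :
      Algebra.trace ℚ K (ω * x * y) = ∑ i, a i * v.repr x i * v.repr y i := by
    conv_lhs => rw [← v.sum_repr x, ← v.sum_repr y]
    rw [Finset.mul_sum, map_sum]
    refine Finset.sum_congr rfl fun i _ => ?_
    rw [Finset.mul_sum, Finset.sum_mul, map_sum, Finset.sum_eq_single i]
    · rw [mul_smul_comm, mul_smul_comm, smul_mul_assoc, map_smul, map_smul, horth, if_pos rfl,
        smul_eq_mul, smul_eq_mul]
      ring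
    · intro j _ hj
      rw [mul_smul_comm, mul_smul_comm, smul_mul_assoc, map_smul, map_smul, horth, if_neg hj,
        smul_zero, smul_zero]
    · simp
  have hz (i) : ∃ z : ℤ, a i = z := by
    obtain ⟨w, hw⟩ := mul_mem_intSub (hv i) (hv i)
    have h := hωint w
    change (w : K) = _ at hw
    rw [hw, traceChar_apply, ← mul_assoc, horth, if_pos rfl] at h
    exact ratExp_eq_one_iff.1 h
  choose z hz using hz
  have hz0 (i) : z i ≠ 0 := by
    have := ha i
    rw [hz] at this
    exact_mod_cast this
  have hzQ (i) : (z i : ℚ) ≠ 0 := by exact_mod_cast hz0 i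
  let L₀ : AddSubgroup K :=
    { carrier := {x | ∀ i, ∃ n : ℤ, v.repr x i = n}
      zero_mem' := fun i => ⟨0, by simp⟩
      add_mem' := fun {x y} hx hy i => by
        obtain ⟨m, hm⟩ := hx i
        obtain ⟨n, hn⟩ := hy i
        exact ⟨m + n, by simp [hm, hn]⟩
      neg_mem' := fun {x} hx i => by
        obtain ⟨m, hm⟩ := hx i
        exact ⟨-m, by simp [hm]⟩ }
  let A : AddSubgroup K :=
    { carrier := {x | ∀ i, ∃ n : ℤ, 2 * z i * v.repr x i = n}
      zero_mem' := fun i => ⟨0, by simp⟩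
      add_mem' := fun {x y} hx hy i => by
        obtain ⟨m, hm⟩ := hx i
        obtain ⟨n, hn⟩ := hy i
        exact ⟨m + n, by simp [mul_add, hm, hn]⟩
      neg_mem' := fun {x} hx i => by
        obtain ⟨m, hm⟩ := hx i
        exact ⟨-m, by simp [hm]⟩ }
  have hpair (x y : K) : traceChar (2 * ω * x) y =
      ratExp (∑ i, 2 * z i * v.repr x i * v.repr y i) := by
    rw [traceChar_apply, show 2 * ω * x * y = (2 : ℚ) • (ω * x * y) by
      rw [Rat.smul_def]; push_cast; ring, map_smul, htr, smul_eq_mul, Finset.mul_sum]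
    congr 1
    refine Finset.sum_congr rfl fun i _ => ?_
    rw [hz]
    ring
  have hL₀ : L₀ ≤ intSub K := by
    intro x hx
    rw [← v.sum_repr x]
    refine AddSubgroup.sum_mem _ fun i _ => ?_
    obtain ⟨n, hn⟩ := hx i
    rw [hn, Int.cast_smul_eq_zsmul]
    exact AddSubgroup.zsmul_mem _ (hv i) n
  have hOP : intSub K ≤ dualSub (2 * ω) := by
    rintro _ ⟨x, rfl⟩ y
    have h := hωint (2 * x * y)
    rw [← h]
    refine traceChar_congr ?_
    simp only [map_mul, map_ofNat, RingHom.toAddMonoidHom_eq_coe, AddMonoidHom.coe_coe]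
    ring
  have hPA : dualSub (2 * ω) ≤ A := by
    intro x hx i
    obtain ⟨w, hw⟩ := hv i
    have h := hx w
    change (w : K) = _ at hw
    rw [hw, traceChar_congr (show 2 * ω * (x * v i) = 2 * ω * x * v i by ring), hpair,
      Finset.sum_eq_single i] at h
    · simpa using ratExp_eq_one_iff.1 h
    · intro j _ hj
      simp [hj.symm]
    · simp
  let r₀ : (∀ i, Fin (2 * (z i).natAbs)) → K := fun k => ∑ i, ((k i : ℚ) / (2 * z i)) • v i
  have hr₀ (k) (i) : v.repr (r₀ k) i = (k i : ℚ) / (2 * z i) := by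
    simp only [r₀]
    rw [v.repr_sum_self]
  have hsys : IsCosetSystem A L₀ r₀ := by
    refine ⟨fun k i => ⟨k i, ?_⟩, fun x hx => ?_⟩
    · rw [hr₀]
      have := hzQ i
      field_simp
      simp
    · choose n hn using hx
      have hn' (i) : v.repr x i = n i / (2 * z i) := by
        rw [← hn]
        have := hzQ i
        field_simp
      choose k hk hk' using fun i => existsUnique_fin_sub_div (hz0 i) (n i)
      have key (k) : x - r₀ k ∈ L₀ ↔ ∀ i, ∃ m : ℤ, (n i : ℚ) / (2 * z i) - k i / (2 * z i) = m := by
        refine forall_congr' fun i => ?_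
        rw [map_sub, Finsupp.sub_apply, hr₀, hn']
      exact ⟨k, (key k).2 hk, fun k₂ h => funext fun i => hk' i _ ((key k₂).1 h i)⟩
  have hmain := IsCosetSystem.sum_eq_card_mul hsys (hsys.restrict (hOP.trans hPA) hL₀) hr hL₀ hOP hPA
    (fun x => traceChar ω (x ^ 2)) (fun x => traceChar (2 * ω * x))
    (fun x _ l hl => by
      obtain ⟨w, rfl⟩ := hl
      have h := hωint (w ^ 2)
      rw [RingOfIntegers.coe_eq_algebraMap, map_pow] at h
      rw [traceChar_add_sq]
      exact (congrArg _ h).trans (mul_one _))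
    (fun x _ => by
      refine ⟨fun hx l hl => ?_, fun h y => ?_⟩
      · obtain ⟨w, rfl⟩ := hl
        rw [← hx w]
        exact traceChar_congr (mul_assoc _ _ _)
      · rw [← h _ (coe_mem_intSub y)]
        exact traceChar_congr (mul_assoc _ _ _).symm)
    (fun x hx l hl => by
      rw [hpair]
      choose m hm using hx
      choose n hn using hl
      refine ratExp_eq_one_iff.2 ⟨∑ i, m i * n i, ?_⟩
      push_cast
      simp only [hm, hn])
  have hprod : ∑ k, traceChar ω (r₀ k ^ 2) =
      ∏ i, (Real.sqrt (2 * (z i).natAbs) * zetaEight ^ (SignType.sign (z i) : ℤ) : ℂ) := by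
    rw [Finset.prod_congr rfl fun i _ => (sum_ratExp_sq (hz0 i)).symm, Finset.prod_univ_sum,
      Fintype.piFinset_univ]
    refine Finset.sum_congr rfl fun k _ => ?_
    rw [traceChar_apply, sq, ← mul_assoc, htr, ratExp_sum]
    refine Finset.prod_congr rfl fun i _ => ?_
    rw [hr₀, hz]
    congr 1
    have := hzQ i
    field_simp
    ring
  have hcard : (0 : ℝ) < Fintype.card {k // r₀ k ∈ intSub K} := by
    obtain ⟨k, -⟩ := (hsys.restrict (hOP.trans hPA) hL₀).existsUnique 0 (AddSubgroup.zero_mem _)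
    exact_mod_cast Fintype.card_pos_iff.2 ⟨k⟩
  have hsign (i) : SignType.sign (z i) = SignType.sign (a i) := by
    rw [hz]
    rcases (hz0 i).lt_or_gt with h | h
    · rw [sign_neg h, sign_neg (by exact_mod_cast h)]
    · rw [sign_pos h, sign_pos (by exact_mod_cast h)]
  refine ⟨(∏ i, Real.sqrt (2 * (z i).natAbs)) / Fintype.card {k // r₀ k ∈ intSub K},
    div_pos (Finset.prod_pos fun i _ => Real.sqrt_pos.2 ?_) hcard, ?_⟩
  · have := Int.natAbs_pos.2 (hz0 i)
    positivity
  · rw [← sum_sign_trace_form ω hω (Fintype.card_fin _) v a ha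
      fun i j => (horth i j).trans (by congr)]
    rw [hprod, Finset.prod_mul_distrib] at hmain
    simp only [hsign] at hmain
    have hc : ((Fintype.card {k // r₀ k ∈ intSub K} : ℝ) : ℂ) ≠ 0 := by exact_mod_cast hcard.ne'
    have hzpow : zetaEight ^ (∑ i, (SignType.sign (a i) : ℤ)) =
        ∏ i, zetaEight ^ (SignType.sign (a i) : ℤ) := by
      induction (Finset.univ : Finset (Fin (Module.finrank ℚ K))) using Finset.induction_on with
      | empty => simp
      | insert i s hi ih =>
        rw [Finset.sum_insert hi, Finset.prod_insert hi, zpow_add₀ zetaEight_ne_zero, ih]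
    rw [hzpow]
    push_cast at hc ⊢
    field_simp
    rw [mul_comm, ← hmain]

section FiniteField

variable {F : Type*} [Field F] [Fintype F]

theorem sum_comp_sq (hF : ringChar F ≠ 2) (g : F → ℂ) :
    ∑ c, g (c ^ 2) = ∑ t, ((quadraticChar F t : ℂ) + 1) * g t := by
  rw [← Finset.sum_fiberwise_of_maps_to (g := fun c : F => c ^ 2) (t := Finset.univ) (by simp)]
  refine Finset.sum_congr rfl fun t _ => ?_
  have h := quadraticChar_card_sqrts hF t
  rw [Finset.sum_congr rfl fun c hc => by rw [(Finset.mem_filter.1 hc).2], Finset.sum_const,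
    nsmul_eq_mul]
  congr 1
  have : (({x : F | x ^ 2 = t}.toFinset.card : ℤ) : ℂ) = (quadraticChar F t : ℂ) + 1 := by
    rw [h]
    push_cast
    rfl
  rw [← this, Int.cast_natCast]
  congr 2
  ext x
  simp

theorem sum_addChar_mul_sq (hF : ringChar F ≠ 2) {φ : AddChar F ℂ} (hφ : φ ≠ 1) {u : F}
    (hu : u ≠ 0) : ∑ c, φ (u * c ^ 2) = quadraticChar F u * ∑ c, φ (c ^ 2) := by
  have hsum : ∑ t, φ t = 0 := AddChar.sum_eq_zero_of_ne_one hφ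
  have hbij : Function.Bijective (u * ·) := mulLeft_bijective₀ u hu
  have hsum' : ∑ t, φ (u * t) = 0 := (hbij.sum_comp fun t => φ t).trans hsum
  rw [sum_comp_sq hF fun t => φ (u * t), sum_comp_sq hF φ]
  simp only [add_mul, one_mul, Finset.sum_add_distrib, hsum, hsum', add_zero]
  rw [← hbij.sum_comp fun t => (quadraticChar F t : ℂ) * φ t, Finset.mul_sum]
  refine Finset.sum_congr rfl fun t _ => ?_
  rw [map_mul (quadraticChar F)]
  have : (quadraticChar F u : ℂ) ^ 2 = 1 := by exact_mod_cast quadraticChar_sq_one hu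
  push_cast
  linear_combination (-(quadraticChar F t : ℂ) * φ (u * t)) * this

end FiniteField

theorem exists_addChar_quotient {R : Type*} [CommRing R] (I : Ideal R) (ψ : AddChar R ℂ)
    (h : ∀ x ∈ I, ψ x = 1) : ∃ φ : AddChar (R ⧸ I) ℂ, ∀ x, φ (Ideal.Quotient.mk I x) = ψ x := by
  have key (x y : R) (hxy : Ideal.Quotient.mk I x = Ideal.Quotient.mk I y) : ψ x = ψ y := by
    rw [← sub_add_cancel x y, AddChar.map_add_eq_mul, h _ (Ideal.Quotient.eq.1 hxy), one_mul]
  have hout (x : R) : ψ (Quotient.out (Ideal.Quotient.mk I x)) = ψ x :=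
    key _ _ (Ideal.Quotient.mk_out _)
  refine ⟨⟨fun q => ψ q.out, ?_, ?_⟩, hout⟩
  · rw [← map_zero (Ideal.Quotient.mk I), hout, AddChar.map_zero_eq_one]
  · intro a b
    obtain ⟨a, rfl⟩ := Ideal.Quotient.mk_surjective a
    obtain ⟨b, rfl⟩ := Ideal.Quotient.mk_surjective b
    rw [← map_add, hout, hout, hout, AddChar.map_add_eq_mul]

theorem quadSym_mul {I J : Ideal (𝓞 K)} (hI : I ≠ ⊥) (hJ : J ≠ ⊥) (α : 𝓞 K) :
    quadSym (I * J) α = quadSym I α * quadSym J α := by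
  simp only [quadSym, UniqueFactorizationMonoid.normalizedFactors_mul hI hJ, Multiset.map_add,
    Multiset.prod_add]

theorem quadSym_top (α : 𝓞 K) : quadSym ⊤ α = 1 := by
  rw [quadSym, ← Ideal.one_eq_top, UniqueFactorizationMonoid.normalizedFactors_one]
  simp

theorem quadSym_prime {𝔭 : Ideal (𝓞 K)} [h𝔭 : 𝔭.IsPrime] (hbot : 𝔭 ≠ ⊥) (α : 𝓞 K) :
    quadSym 𝔭 α = legSym 𝔭 α := by
  have : Irreducible 𝔭 := (Ideal.prime_of_isPrime hbot h𝔭).irreducible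
  simp [quadSym, UniqueFactorizationMonoid.normalizedFactors_irreducible this]

theorem legSym_eq_quadraticChar {K : Type*} [Field K] {𝔭 : Ideal (𝓞 K)} [𝔭.IsMaximal]
    [Fintype (𝓞 K ⧸ 𝔭)] (α : 𝓞 K) :
    letI := Ideal.Quotient.field 𝔭
    legSym 𝔭 α = quadraticChar (𝓞 K ⧸ 𝔭) (Ideal.Quotient.mk 𝔭 α) := by
  rw [quadraticChar_apply, quadraticCharFun, legSym]
  congr

theorem exists_isCosetSystem_ideal (I : Ideal (𝓞 K)) {J : Ideal (𝓞 K)} (hJ : J ≠ ⊥) :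
    ∃ (ι : Type) (_ : Fintype ι) (r : ι → 𝓞 K),
      IsCosetSystem (Submodule.toAddSubgroup I) (Submodule.toAddSubgroup J) r := by
  have : Finite (𝓞 K ⧸ J) := Ideal.finiteQuotientOfFreeOfNeBot J hJ
  have : (Submodule.toAddSubgroup J).FiniteIndex := by
    have : Finite (𝓞 K ⧸ (Submodule.toAddSubgroup J)) := this
    exact AddSubgroup.finiteIndex_of_finite_quotient
  obtain ⟨n, r, hr⟩ := IsCosetSystem.exists_of_finite (Submodule.toAddSubgroup I)
    (Submodule.toAddSubgroup J)
  exact ⟨Fin n, inferInstance, r, hr⟩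

/-- `ψ` induces a perfect pairing between `𝔞 / 𝔞𝔟` and itself via `(x, y) ↦ ψ (xy)`. -/
def IsPerfectOn {R : Type*} [CommRing R] (ψ : AddChar R ℂ) (𝔞 𝔟 : Ideal R) : Prop :=
  ∀ x ∈ 𝔞 ^ 2, (∀ y, ψ (x * y) = 1) ↔ x ∈ 𝔞 ^ 2 * 𝔟

theorem IsPerfectOn.eq_one {R : Type*} [CommRing R] {ψ : AddChar R ℂ} {𝔞 𝔟 : Ideal R}
    (h : IsPerfectOn ψ 𝔞 𝔟) {x : R} (hx : x ∈ 𝔞 ^ 2 * 𝔟) : ψ x = 1 := by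
  simpa using (h x (Ideal.mul_le_left hx)).2 hx 1

theorem IsPerfectOn.mul_left {R : Type*} [CommRing R] {ψ : AddChar R ℂ} {𝔞 𝔟 𝔠 : Ideal R}
    (h : IsPerfectOn ψ 𝔞 (𝔟 * 𝔠)) (hcop : IsCoprime 𝔟 𝔠) : IsPerfectOn ψ (𝔞 * 𝔟) 𝔠 := by
  have hle : (𝔞 * 𝔟) ^ 2 ≤ 𝔞 ^ 2 := Ideal.pow_right_mono Ideal.mul_le_left 2
  intro x hx
  rw [h x (hle hx)]
  constructor
  · intro hx'
    obtain ⟨b, hb, c, hc, hbc⟩ := Ideal.isCoprime_iff_exists.1 hcop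
    rw [← mul_one x, ← hbc, mul_add]
    refine Ideal.add_mem _ ?_ (Ideal.mul_mem_mul hx hc)
    have := Ideal.mul_mem_mul hx' hb
    rwa [show 𝔞 ^ 2 * (𝔟 * 𝔠) * 𝔟 = (𝔞 * 𝔟) ^ 2 * 𝔠 by ring] at this
  · intro hx'
    rw [show (𝔞 * 𝔟) ^ 2 * 𝔠 = 𝔞 ^ 2 * (𝔟 * 𝔠) * 𝔟 by ring] at hx'
    exact Ideal.mul_le_left hx'

theorem mem_mul_of_mul_mem {R : Type*} [CommRing R] {I J : Ideal R} {u x : R}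
    (hu : IsCoprime J (Ideal.span {u})) (hx : x ∈ I) (h : u * x ∈ I * J) : x ∈ I * J := by
  obtain ⟨b, hb, c, hc, hbc⟩ := Ideal.isCoprime_iff_exists.1 hu
  obtain ⟨d, rfl⟩ := Ideal.mem_span_singleton'.1 hc
  rw [← mul_one x, ← hbc, mul_add]
  refine Ideal.add_mem _ (Ideal.mul_mem_mul hx hb) ?_
  rw [show x * (d * u) = d * (u * x) by ring]
  exact Ideal.mul_mem_left _ _ h

section Symbol

variable {𝔞 𝔟 𝔭 : Ideal (𝓞 K)} {ψ : AddChar (𝓞 K) ℂ}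

theorem exists_span_eq_mul_of_notMem {x : 𝓞 K} (hx : x ∈ 𝔞) (hx' : x ∉ 𝔞 * 𝔭) :
    ∃ 𝔪 : Ideal (𝓞 K), Ideal.span {x} = 𝔞 * 𝔪 ∧ ¬ 𝔪 ≤ 𝔭 := by
  obtain ⟨𝔪, h⟩ := Ideal.dvd_iff_le.2 ((Ideal.span_singleton_le_iff_mem _).2 hx)
  refine ⟨𝔪, h, fun hle => hx' ?_⟩
  rw [← Ideal.span_singleton_le_iff_mem, h]
  exact Ideal.mul_mono_right hle

theorem sum_mul_sq_eq_of_prime [h𝔭 : 𝔭.IsMaximal] (h𝔞 : 𝔞 ≠ ⊥) (hbot : 𝔭 ≠ ⊥)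
    (h2 : IsCoprime 𝔭 (Ideal.span {(2 : 𝓞 K)})) {α : 𝓞 K} (hα : IsCoprime 𝔭 (Ideal.span {α}))
    (hψ : IsPerfectOn ψ 𝔞 𝔭) {ι : Type*} [Fintype ι] {r : ι → 𝓞 K}
    (hr : IsCosetSystem (Submodule.toAddSubgroup 𝔞) (Submodule.toAddSubgroup (𝔞 * 𝔭)) r) :
    ∑ i, ψ (α * r i ^ 2) = quadSym 𝔭 α * ∑ i, ψ (r i ^ 2) := by
  let := Ideal.Quotient.field 𝔭
  have : Finite (𝓞 K ⧸ 𝔭) := Ideal.finiteQuotientOfFreeOfNeBot 𝔭 hbot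
  let := Fintype.ofFinite (𝓞 K ⧸ 𝔭)
  have hnot {u : 𝓞 K} (hu : IsCoprime 𝔭 (Ideal.span {u})) : u ∉ 𝔭 := fun h =>
    h𝔭.ne_top <| (Ideal.eq_top_iff_one _).2 <| by
      obtain ⟨b, hb, c, hc, hbc⟩ := Ideal.isCoprime_iff_exists.1 hu
      rw [← hbc]
      exact 𝔭.add_mem hb ((Ideal.span_singleton_le_iff_mem _).2 h hc)
  obtain ⟨x₀, hx₀, hx₀'⟩ : ∃ x ∈ 𝔞, x ∉ 𝔞 * 𝔭 := by
    by_contra! hle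
    have : 𝔞 * 𝔭 = 𝔞 * ⊤ := by
      rw [Ideal.mul_top]
      exact le_antisymm Ideal.mul_le_left hle
    exact h𝔭.ne_top (mul_left_cancel₀ h𝔞 this)
  obtain ⟨𝔪, h𝔪, h𝔪'⟩ := exists_span_eq_mul_of_notMem hx₀ hx₀'
  have hsup : 𝔪 ⊔ 𝔭 = ⊤ := by
    rw [sup_comm]
    exact h𝔭.out.2 _ (lt_of_le_of_ne le_sup_left fun h => h𝔪' (by rw [h]; exact le_sup_right))
  obtain ⟨φ, hφ⟩ := exists_addChar_quotient 𝔭 (AddChar.mulShift ψ (x₀ ^ 2)) fun x hx => by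
    rw [AddChar.mulShift_apply]
    exact hψ.eq_one (Ideal.mul_mem_mul (Ideal.pow_mem_pow hx₀ 2) hx)
  have hφ1 : φ ≠ 1 := by
    rintro rfl
    have h : x₀ ^ 2 ∈ 𝔞 ^ 2 * 𝔭 := (hψ _ (Ideal.pow_mem_pow hx₀ 2)).1 fun y => by
      rw [← AddChar.mulShift_apply, ← hφ, AddChar.one_apply]
    rw [← Ideal.span_singleton_le_iff_mem, ← Ideal.span_singleton_pow, h𝔪, mul_pow] at h
    have := Ideal.dvd_iff_le.2 h
    rw [mul_dvd_mul_iff_left (pow_ne_zero 2 h𝔞)] at this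
    exact h𝔪' (h𝔭.isPrime.le_of_pow_le (Ideal.dvd_iff_le.1 this))
  have hsys : IsCosetSystem (Submodule.toAddSubgroup 𝔞) (Submodule.toAddSubgroup (𝔞 * 𝔭))
      fun q : 𝓞 K ⧸ 𝔭 => x₀ * Quotient.out q := by
    refine ⟨fun q => 𝔞.mul_mem_right _ hx₀, fun x hx => ?_⟩
    have hx' : x ∈ Ideal.span {x₀} ⊔ 𝔞 * 𝔭 := by
      rw [h𝔪, ← Ideal.mul_sup, hsup, Ideal.mul_top]
      exact hx
    obtain ⟨y, hy, z, hz, rfl⟩ := Submodule.mem_sup.1 hx'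
    obtain ⟨c, rfl⟩ := Ideal.mem_span_singleton'.1 hy
    have key (q : 𝓞 K ⧸ 𝔭) : c * x₀ + z - x₀ * Quotient.out q ∈ 𝔞 * 𝔭 ↔
        q = Ideal.Quotient.mk 𝔭 c := by
      rw [show c * x₀ + z - x₀ * Quotient.out q = x₀ * (c - Quotient.out q) + z by ring,
        Ideal.add_mem_iff_left _ hz, ← Ideal.span_singleton_le_iff_mem,
        ← Ideal.span_singleton_mul_span_singleton, h𝔪, mul_assoc, ← Ideal.dvd_iff_le,
        mul_dvd_mul_iff_left h𝔞, Ideal.dvd_iff_le, h𝔭.isPrime.mul_le, or_iff_right h𝔪',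
        Ideal.span_singleton_le_iff_mem, ← Ideal.Quotient.eq, eq_comm, Ideal.Quotient.mk_out]
    exact ⟨_, (key _).2 rfl, fun q hq => (key q).1 hq⟩
  have hper (u : 𝓞 K) (x) (hx : x ∈ 𝔞) (l) (hl : l ∈ 𝔞 * 𝔭) :
      ψ (u * (x + l) ^ 2) = ψ (u * x ^ 2) := by
    rw [show u * (x + l) ^ 2 = u * x ^ 2 + (2 * u * (x * l) + u * (l * l)) by ring,
      AddChar.map_add_eq_mul, hψ.eq_one (x := _ + _), mul_one]
    have hmem {y} (hy : y ∈ 𝔞) : y * l ∈ 𝔞 ^ 2 * 𝔭 := by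
      rw [sq, mul_assoc]
      exact Ideal.mul_mem_mul hy hl
    exact Ideal.add_mem _ (Ideal.mul_mem_left _ _ (hmem hx))
      (Ideal.mul_mem_left _ _ (hmem (Ideal.mul_le_left hl)))
  have hval (u : 𝓞 K) (q : 𝓞 K ⧸ 𝔭) : ψ (u * (x₀ * Quotient.out q) ^ 2) =
      φ (Ideal.Quotient.mk 𝔭 u * q ^ 2) := by
    conv_rhs => rw [← Ideal.Quotient.mk_out q, ← map_pow, ← map_mul, hφ, AddChar.mulShift_apply]
    congr 1
    ring
  have hF : ringChar (𝓞 K ⧸ 𝔭) ≠ 2 := by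
    intro h
    refine hnot h2 (Ideal.Quotient.eq_zero_iff_mem.1 ?_)
    have := ringChar.Nat.cast_ringChar (R := 𝓞 K ⧸ 𝔭)
    rw [h] at this
    rw [map_ofNat]
    exact_mod_cast this
  have h₁ (u : 𝓞 K) := hr.sum_eq hsys (f := fun x => ψ (u * x ^ 2)) fun x hx l hl => hper u x hx l hl
  have h₂ := h₁ 1
  simp only [hval] at h₁ h₂
  simp only [map_one, one_mul] at h₂
  rw [h₁, h₂, sum_addChar_mul_sq hF hφ1 (mt Ideal.Quotient.eq_zero_iff_mem.1 (hnot hα)),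
    quadSym_prime hbot, legSym_eq_quadraticChar]

end Symbol

section Symbol

variable {𝔞 𝔟 𝔠 𝔭 : Ideal (𝓞 K)} {ψ : AddChar (𝓞 K) ℂ}

theorem sum_mul_sq_eq_card_mul (h𝔞 : 𝔞 ≠ ⊥) (h𝔭 : 𝔭 ≠ ⊥) (h𝔠 : 𝔠 ≠ ⊥)
    (h2 : IsCoprime 𝔭 (Ideal.span {(2 : 𝓞 K)})) {u : 𝓞 K} (hu : IsCoprime 𝔭 (Ideal.span {u}))
    (hψ : IsPerfectOn ψ 𝔞 (𝔭 * (𝔭 * 𝔠))) {ι₀ ι₁ ι₂ : Type*} [Fintype ι₀] [Fintype ι₁] [Fintype ι₂]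
    {r₀ : ι₀ → 𝓞 K} {r₁ : ι₁ → 𝓞 K} {r₂ : ι₂ → 𝓞 K}
    (h₀ : IsCosetSystem (Submodule.toAddSubgroup 𝔞)
      (Submodule.toAddSubgroup (𝔞 * (𝔭 * (𝔭 * 𝔠)))) r₀)
    (h₁ : IsCosetSystem (Submodule.toAddSubgroup (𝔞 * 𝔭 * 𝔠))
      (Submodule.toAddSubgroup (𝔞 * (𝔭 * (𝔭 * 𝔠)))) r₁)
    (h₂ : IsCosetSystem (Submodule.toAddSubgroup (𝔞 * 𝔭))
      (Submodule.toAddSubgroup (𝔞 * 𝔭 * 𝔠)) r₂) :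
    ∑ i, ψ (u * r₀ i ^ 2) = Fintype.card ι₁ * ∑ j, ψ (u * r₂ j ^ 2) := by
  have e₁ : 𝔞 * (𝔭 * (𝔭 * 𝔠)) = 𝔞 * 𝔭 * 𝔠 * 𝔭 := by ring
  have hmem (I J : Ideal (𝓞 K)) {x l : 𝓞 K} (hx : x ∈ I) (hl : l ∈ J)
      (hIJ : ∃ M, I * J = 𝔞 ^ 2 * (𝔭 * (𝔭 * 𝔠)) * M) (d : 𝓞 K) : ψ (d * (x * l)) = 1 := by
    obtain ⟨M, hM⟩ := hIJ
    refine hψ.eq_one (Ideal.mul_mem_left _ _ ?_)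
    have := Ideal.mul_mem_mul hx hl
    rw [hM] at this
    exact Ideal.mul_le_left this
  refine IsCosetSystem.sum_eq_card_mul h₀ h₁ h₂ ?_ ?_ ?_ (fun x => ψ (u * x ^ 2))
    (fun x => AddChar.mulShift ψ (2 * u * x)) ?_ ?_ ?_
  · rw [e₁]
    exact Ideal.mul_le_left
  · exact Ideal.mul_le_left
  · exact Ideal.mul_le_left
  · intro x hx l hl
    simp only [AddChar.mulShift_apply]
    rw [show u * (x + l) ^ 2 = u * x ^ 2 + 2 * u * x * l + u * (l * l) by ring,
      AddChar.map_add_eq_mul, AddChar.map_add_eq_mul,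
      hmem (𝔞 * 𝔭 * 𝔠) (𝔞 * 𝔭 * 𝔠) hl hl ⟨𝔠, by ring⟩, mul_one]
  · intro x hx
    simp only [AddChar.mulShift_apply]
    constructor
    · intro hx' l hl
      rw [mul_assoc]
      exact hmem (𝔞 * 𝔭) (𝔞 * 𝔭 * 𝔠) hx' hl ⟨1, by ring⟩ _
    · intro h
      have h' : Ideal.span {2 * u * x} * (𝔞 * 𝔭 * 𝔠) ≤ 𝔞 * 𝔭 * (𝔞 * 𝔭 * 𝔠) := by
        rw [Ideal.span_singleton_mul_le_iff]
        intro l hl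
        rw [show 𝔞 * 𝔭 * (𝔞 * 𝔭 * 𝔠) = 𝔞 ^ 2 * (𝔭 * (𝔭 * 𝔠)) by ring]
        refine (hψ _ ?_).1 fun y => ?_
        · rw [mul_assoc, sq]
          exact Ideal.mul_mem_left _ _ (Ideal.mul_mem_mul hx
            (Ideal.mul_le_left (Ideal.mul_le_left hl)))
        · rw [mul_assoc]
          exact h _ (Ideal.mul_mem_right _ _ hl)
      rw [← Ideal.dvd_iff_le, mul_dvd_mul_iff_right (mul_ne_zero (mul_ne_zero h𝔞 h𝔭) h𝔠),
        Ideal.dvd_iff_le, Ideal.span_singleton_le_iff_mem] at h'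
      refine mem_mul_of_mul_mem (u := 2 * u) ?_ hx h'
      rw [← Ideal.span_singleton_mul_span_singleton]
      exact h2.mul_right hu
  · intro x hx l hl
    simp only [AddChar.mulShift_apply]
    rw [mul_assoc]
    exact hmem 𝔞 (𝔞 * (𝔭 * (𝔭 * 𝔠))) hx hl ⟨1, by ring⟩ _

theorem sum_mul_sq_eq_mul_sum (hbot : 𝔟 ≠ ⊥) (h2 : IsCoprime 𝔟 (Ideal.span {(2 : 𝓞 K)}))
    {α : 𝓞 K} (hα : IsCoprime 𝔟 (Ideal.span {α})) (h𝔞 : 𝔞 ≠ ⊥) (hψ : IsPerfectOn ψ 𝔞 𝔟)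
    {ι : Type} [Fintype ι] {r : ι → 𝓞 K}
    (hr : IsCosetSystem (Submodule.toAddSubgroup 𝔞) (Submodule.toAddSubgroup (𝔞 * 𝔟)) r) :
    ∑ i, ψ (α * r i ^ 2) = quadSym 𝔟 α * ∑ i, ψ (r i ^ 2) := by
  induction 𝔟 using WellFoundedGT.induction generalizing 𝔞 ι with
  | ind 𝔟 ih =>
  obtain rfl | htop := eq_or_ne 𝔟 ⊤
  · rw [quadSym_top, Int.cast_one, one_mul]
    have h (u : 𝓞 K) (i : ι) : ψ (u * r i ^ 2) = 1 := by
      refine hψ.eq_one (Ideal.mul_mem_left _ _ ?_)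
      rw [Ideal.mul_top]
      exact Ideal.pow_mem_pow (hr.mem i) 2
    have h' := h 1
    simp only [one_mul] at h'
    simp only [h, h']
  obtain ⟨𝔭, h𝔭, hle⟩ := Ideal.exists_le_maximal 𝔟 htop
  obtain ⟨𝔠, rfl⟩ := Ideal.dvd_iff_le.2 hle
  have hpbot : 𝔭 ≠ ⊥ := left_ne_zero_of_mul hbot
  have hcbot : 𝔠 ≠ ⊥ := right_ne_zero_of_mul hbot
  have h2p := h2.of_mul_left_left
  have hαp := hα.of_mul_left_left
  have hp1 : ¬ IsUnit 𝔭 := fun h => h𝔭.ne_top (Ideal.isUnit_iff.1 h)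
  by_cases hdvd : 𝔭 ∣ 𝔠
  · obtain ⟨𝔠, rfl⟩ := hdvd
    have hcbot' : 𝔠 ≠ ⊥ := right_ne_zero_of_mul hcbot
    obtain ⟨ι₁, _, r₁, h₁⟩ := exists_isCosetSystem_ideal (𝔞 * 𝔭 * 𝔠) (mul_ne_zero h𝔞 hbot)
    obtain ⟨ι₂, _, r₂, h₂⟩ := exists_isCosetSystem_ideal (𝔞 * 𝔭)
      (mul_ne_zero (mul_ne_zero h𝔞 hpbot) hcbot')
    have key := fun u hu => sum_mul_sq_eq_card_mul (u := u) h𝔞 hpbot hcbot' h2p hu hψ hr h₁ h₂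
    have key₁ := key 1 (by simp [Ideal.isCoprime_iff_sup_eq])
    simp only [one_mul] at key₁
    have hψ' : IsPerfectOn ψ (𝔞 * 𝔭) 𝔠 := by
      intro x hx
      rw [hψ x (Ideal.pow_right_mono Ideal.mul_le_left 2 hx),
        show 𝔞 ^ 2 * (𝔭 * (𝔭 * 𝔠)) = (𝔞 * 𝔭) ^ 2 * 𝔠 by ring]
    have hlt : 𝔭 * (𝔭 * 𝔠) < 𝔠 := by
      rw [← mul_assoc]
      exact Ideal.dvdNotUnit_iff_lt.1 ⟨hcbot', 𝔭 * 𝔭, fun h => hp1 (isUnit_of_mul_isUnit_left h),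
        mul_comm _ _⟩
    have := ih 𝔠 hlt hcbot' h2.of_mul_left_right.of_mul_left_right
      hα.of_mul_left_right.of_mul_left_right (mul_ne_zero h𝔞 hpbot) hψ' h₂
    have hsq : (quadSym 𝔭 α : ℂ) ^ 2 = 1 := by
      rw [quadSym_prime hpbot, legSym, if_neg]
      · split_ifs <;> simp
      · rw [Ideal.Quotient.eq_zero_iff_mem]
        intro h
        refine h𝔭.ne_top ?_
        rw [← Ideal.isCoprime_iff_sup_eq.1 hαp]
        exact (sup_eq_left.2 ((Ideal.span_singleton_le_iff_mem _).2 h)).symm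
    rw [key α hαp, key₁, this, quadSym_mul hpbot hcbot, quadSym_mul hpbot hcbot']
    push_cast
    linear_combination (-(quadSym 𝔠 α : ℂ) * Fintype.card ι₁ * ∑ j, ψ (r₂ j ^ 2)) * hsq
  · have hcop : IsCoprime 𝔭 𝔠 := by
      rw [Ideal.isCoprime_iff_sup_eq]
      exact h𝔭.out.2 _ (lt_of_le_of_ne le_sup_left fun h => hdvd <| Ideal.dvd_iff_le.2 <| by
        rw [h]; exact le_sup_right)
    obtain ⟨ι₁, _, r₁, h₁⟩ := exists_isCosetSystem_ideal (𝔞 * 𝔠) (mul_ne_zero h𝔞 hbot)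
    obtain ⟨ι₂, _, r₂, h₂⟩ := exists_isCosetSystem_ideal (𝔞 * 𝔭) (mul_ne_zero h𝔞 hbot)
    have hsys : IsCosetSystem (Submodule.toAddSubgroup 𝔞)
        (Submodule.toAddSubgroup (𝔞 * (𝔭 * 𝔠))) fun p : ι₁ × ι₂ => r₁ p.1 + r₂ p.2 := by
      refine h₁.add h₂ Ideal.mul_le_left Ideal.mul_le_left ?_ ?_ ?_
      · intro x hx
        obtain ⟨b, hb, c, hc, hbc⟩ := Ideal.isCoprime_iff_exists.1 hcop
        exact ⟨x * c, Ideal.mul_mem_mul hx hc, x * b, Ideal.mul_mem_mul hx hb,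
          by rw [← mul_add, add_comm, hbc, mul_one]⟩
      · intro x hx hx'
        obtain ⟨b, hb, c, hc, hbc⟩ := Ideal.isCoprime_iff_exists.1 hcop
        show x ∈ 𝔞 * (𝔭 * 𝔠)
        rw [← mul_one x, ← hbc, mul_add]
        refine Ideal.add_mem _ ?_ ?_
        · have := Ideal.mul_mem_mul (I := 𝔞 * 𝔠) hx hb
          rwa [mul_assoc, mul_comm 𝔠] at this
        · have := Ideal.mul_mem_mul (I := 𝔞 * 𝔭) hx' hc
          rwa [mul_assoc] at this
      · rw [← mul_assoc]
        exact Ideal.mul_le_left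
    have hcross (u : 𝓞 K) {x y} (hx : x ∈ 𝔞 * 𝔠) (hy : y ∈ 𝔞 * 𝔭) : ψ (u * (x * y)) = 1 := by
      refine hψ.eq_one (Ideal.mul_mem_left _ _ ?_)
      rw [show 𝔞 ^ 2 * (𝔭 * 𝔠) = 𝔞 * 𝔠 * (𝔞 * 𝔭) by ring]
      exact Ideal.mul_mem_mul hx hy
    have hper (u : 𝓞 K) (x) (hx : x ∈ 𝔞) (l) (hl : l ∈ 𝔞 * (𝔭 * 𝔠)) :
        ψ (u * (x + l) ^ 2) = ψ (u * x ^ 2) := by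
      rw [show u * (x + l) ^ 2 = u * x ^ 2 + (2 * u * (x * l) + u * (l * l)) by ring,
        AddChar.map_add_eq_mul, hψ.eq_one (x := _ + _), mul_one]
      have hmem {y} (hy : y ∈ 𝔞) : y * l ∈ 𝔞 ^ 2 * (𝔭 * 𝔠) := by
        rw [sq, mul_assoc]
        exact Ideal.mul_mem_mul hy hl
      exact Ideal.add_mem _ (Ideal.mul_mem_left _ _ (hmem hx))
        (Ideal.mul_mem_left _ _ (hmem (Ideal.mul_le_left hl)))
    have hsum (u : 𝓞 K) : ∑ i, ψ (u * r i ^ 2) =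
        (∑ i, ψ (u * r₁ i ^ 2)) * ∑ j, ψ (u * r₂ j ^ 2) := by
      rw [hr.sum_eq hsys (f := fun x => ψ (u * x ^ 2)) fun x hx l hl => hper u x hx l hl,
        Fintype.sum_prod_type, Finset.sum_mul_sum]
      refine Finset.sum_congr rfl fun i _ => Finset.sum_congr rfl fun j _ => ?_
      rw [show u * (r₁ i + r₂ j) ^ 2 = u * r₁ i ^ 2 + u * r₂ j ^ 2 + 2 * u * (r₁ i * r₂ j) by ring,
        AddChar.map_add_eq_mul, AddChar.map_add_eq_mul, hcross _ (h₁.mem i) (h₂.mem j), mul_one]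
    have hsum₁ := hsum 1
    simp only [one_mul] at hsum₁
    have hlt : 𝔭 * 𝔠 < 𝔠 := Ideal.dvdNotUnit_iff_lt.1 ⟨hcbot, 𝔭, hp1, mul_comm _ _⟩
    have hψ₂ : IsPerfectOn ψ (𝔞 * 𝔭) 𝔠 := hψ.mul_left hcop
    have hψ₁ : IsPerfectOn ψ (𝔞 * 𝔠) 𝔭 := by
      rw [mul_comm 𝔭] at hψ
      exact hψ.mul_left hcop.symm
    rw [mul_comm 𝔭 𝔠, ← mul_assoc] at h₁
    rw [← mul_assoc] at h₂
    rw [hsum, hsum₁, quadSym_mul hpbot hcbot,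
      ih 𝔠 hlt hcbot h2.of_mul_left_right hα.of_mul_left_right (mul_ne_zero h𝔞 hpbot) hψ₂ h₂,
      sum_mul_sq_eq_of_prime (mul_ne_zero h𝔞 hcbot) hpbot h2p hαp hψ₁ h₁]
    push_cast
    ring

end Symbol

/-- The fractional ideal `b⁻¹𝓞` as an additive subgroup of `K`. -/
def divSub (b : 𝓞 K) : AddSubgroup K :=
  (intSub K).comap (AddMonoidHom.mulLeft (b : K))

theorem mem_divSub {b : 𝓞 K} {x : K} : x ∈ divSub b ↔ b * x ∈ intSub K := Iff.rfl

theorem isCosetSystem_divSub {b : 𝓞 K} (hb : b ≠ 0) {ι : Type*} {r : ι → 𝓞 K}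
    (hr : IsCosetSystem (Submodule.toAddSubgroup (⊤ : Ideal (𝓞 K)))
      (Submodule.toAddSubgroup (Ideal.span {b})) r) :
    IsCosetSystem (divSub b) (intSub K) fun i => (r i : K) / b := by
  have hb' : (b : K) ≠ 0 := by simpa using hb
  simp only [div_eq_mul_inv]
  refine hr.map (A := Submodule.toAddSubgroup (⊤ : Ideal (𝓞 K)))
    ((AddMonoidHom.mulRight (b : K)⁻¹).comp (algebraMap (𝓞 K) K).toAddMonoidHom)
    (fun x _ => ?_) (fun y hy => ?_) (fun x _ => ?_)
  · show (b : K) * (x * (b : K)⁻¹) ∈ intSub K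
    rw [mul_comm, inv_mul_cancel_right₀ hb']
    exact coe_mem_intSub x
  · obtain ⟨x, hx⟩ := mem_intSub.1 (mem_divSub.1 hy)
    refine ⟨x, trivial, ?_⟩
    show y - x * (b : K)⁻¹ ∈ intSub K
    rw [hx, mul_comm, inv_mul_cancel_left₀ hb', sub_self]
    exact (intSub K).zero_mem
  · show (x : K) * (b : K)⁻¹ ∈ intSub K ↔ x ∈ Ideal.span {b}
    rw [Ideal.mem_span_singleton', mem_intSub]
    refine exists_congr fun y => ?_
    rw [eq_mul_inv_iff_mul_eq₀ hb', ← map_mul, RingOfIntegers.eq_iff]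

theorem sum_sign_mul_mul {α β : 𝓞 K} {θ : K} (hα : α ≠ 0) (hβ : β ≠ 0) (hθ : θ ≠ 0) :
    zetaEight ^ (∑ φ : K →+* ℝ, (SignType.sign (φ (β * θ)) : ℤ)) *
        zetaEight ^ (∑ φ : K →+* ℝ, (SignType.sign (φ (α * θ)) : ℤ)) =
      muInf α β * (zetaEight ^ (∑ φ : K →+* ℝ, (SignType.sign (φ (α * β * θ)) : ℤ)) *
        zetaEight ^ (∑ φ : K →+* ℝ, (SignType.sign (φ θ) : ℤ))) := by
  have h0 := zetaEight_ne_zero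
  rw [muInf, finprod_eq_prod_of_fintype, Int.cast_prod]
  simp only [← zpow_add₀ h0, ← Finset.sum_add_distrib]
  have hsum (f : (K →+* ℝ) → ℤ) : zetaEight ^ (∑ φ, f φ) = ∏ φ, zetaEight ^ f φ := by
    induction (Finset.univ : Finset (K →+* ℝ)) using Finset.induction_on with
    | empty => simp
    | insert i s hi ih => rw [Finset.sum_insert hi, Finset.prod_insert hi, zpow_add₀ h0, ih]
  rw [hsum, hsum, ← Finset.prod_mul_distrib]
  refine Finset.prod_congr rfl fun φ _ => ?_
  have hne {x : K} (hx : x ≠ 0) : φ x < 0 ∧ SignType.sign (φ x) = -1 ∨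
      ¬ φ x < 0 ∧ SignType.sign (φ x) = 1 := by
    have : φ x ≠ 0 := by simpa using hx
    rcases this.lt_or_gt with h | h
    · exact Or.inl ⟨h, sign_neg h⟩
    · exact Or.inr ⟨h.not_gt, sign_pos h⟩
  have hinv : zetaEight ^ (-2 : ℤ) = -zetaEight ^ (2 : ℤ) := by
    rw [zpow_neg]
    refine inv_eq_of_mul_eq_one_right ?_
    have := zetaEight_pow_four
    simp only [zpow_ofNat]
    linear_combination -this
  have hα' := hne (x := α) (by simpa using hα)
  have hβ' := hne (x := β) (by simpa using hβ)
  simp only [map_mul, sign_mul]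
  rcases hα' with ⟨h₁, e₁⟩ | ⟨h₁, e₁⟩ <;> rcases hβ' with ⟨h₂, e₂⟩ | ⟨h₂, e₂⟩ <;>
    rcases hne hθ with ⟨h₃, e₃⟩ | ⟨h₃, e₃⟩ <;> simp [h₁, h₂, e₁, e₂, e₃, hinv]

theorem muInf_mul_quadSym_mem (α β : 𝓞 K) :
    muInf α β * quadSym (Ideal.span {β}) α ∈ MonoidHom.mrange (SignType.castHom (α := ℤ)) := by
  refine mul_mem ?_ (Submonoid.multiset_prod_mem _ _ ?_)
  · rw [muInf, finprod_eq_prod_of_fintype]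
    refine Submonoid.prod_mem _ fun φ _ => ?_
    split_ifs
    · exact ⟨-1, rfl⟩
    · exact ⟨1, rfl⟩
  · intro x hx
    obtain ⟨𝔭, -, rfl⟩ := Multiset.mem_map.1 hx
    rw [legSym]
    split_ifs
    · exact ⟨0, rfl⟩
    · exact ⟨1, rfl⟩
    · exact ⟨-1, rfl⟩

theorem ringOfIntegers_coe_mul {K : Type*} [Field K] (x y : 𝓞 K) : ((x * y : 𝓞 K) : K) = x * y :=
  map_mul (algebraMap (𝓞 K) K) x y

theorem mul_mem_intSub_of_mem_dualSub {a c : 𝓞 K} {θ : K}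
    (hdual : ∀ x : K, (∀ y : 𝓞 K, traceChar θ (x * y) = 1) → (c : K) * x ∈ intSub K)
    {x : K} (hx : x ∈ dualSub (2 * a * θ)) : ((2 * a * c : 𝓞 K) : K) * x ∈ intSub K := by
  rw [show ((2 * a * c : 𝓞 K) : K) * x = c * (2 * a * x) by
    simp only [map_mul, map_ofNat]; ring]
  refine hdual _ fun y => ?_
  rw [← hx y]
  exact traceChar_congr (by ring)

theorem intSub_le_dualSub {a : 𝓞 K} {θ : K} (h1 : ∀ y : 𝓞 K, traceChar θ y = 1) :
    intSub K ≤ dualSub (2 * a * θ) := by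
  intro x hx y
  obtain ⟨x, rfl⟩ := mem_intSub.1 hx
  rw [← h1 (2 * a * (x * y))]
  refine traceChar_congr ?_
  simp only [map_mul, map_ofNat]
  ring

theorem exists_isCosetSystem_dualSub {a c : 𝓞 K} (ha : a ≠ 0) (hc : c ≠ 0) {θ : K}
    (h1 : ∀ y : 𝓞 K, traceChar θ y = 1)
    (hdual : ∀ x : K, (∀ y : 𝓞 K, traceChar θ (x * y) = 1) → (c : K) * x ∈ intSub K) :
    ∃ (ι : Type) (_ : Fintype ι) (r : ι → K),
      IsCosetSystem (dualSub (2 * a * θ)) (intSub K) r := by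
  have hb : 2 * a * c ≠ 0 := mul_ne_zero (mul_ne_zero two_ne_zero ha) hc
  obtain ⟨ι, _, r, hr⟩ := exists_isCosetSystem_ideal (⊤ : Ideal (𝓞 K))
    (J := Ideal.span {2 * a * c}) (by simpa using hb)
  exact ⟨_, inferInstance, _, (isCosetSystem_divSub hb hr).restrict
    (fun x hx => mul_mem_intSub_of_mem_dualSub hdual hx) (intSub_le_dualSub h1)⟩

/-- Milgram's formula for the form `Tr (aβθx²)`, with the discriminant group split into the parts
prime to `β` and dividing `β`. -/
theorem exists_sum_mul_sum_eq {a c β : 𝓞 K} (ha : a ≠ 0) (hβ : β ≠ 0) {θ : K} (hθ : θ ≠ 0)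
    (h1 : ∀ y : 𝓞 K, traceChar θ y = 1)
    (hdual : ∀ x : K, (∀ y : 𝓞 K, traceChar θ (x * y) = 1) → (c : K) * x ∈ intSub K)
    (hcop : IsCoprime β (2 * a * c)) {ι κ : Type*} [Fintype ι] [Fintype κ]
    {r : ι → 𝓞 K} {s : κ → K}
    (hr : IsCosetSystem (Submodule.toAddSubgroup (⊤ : Ideal (𝓞 K)))
      (Submodule.toAddSubgroup (Ideal.span {β})) r)
    (hs : IsCosetSystem (dualSub (2 * a * θ)) (intSub K) s) :
    ∃ t : ℝ, 0 < t ∧ (∑ i, traceChar (θ / β) (a * r i ^ 2)) *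
        ∑ j, traceChar (a * β * θ) (s j ^ 2) =
      t * zetaEight ^ (∑ φ : K →+* ℝ, (SignType.sign (φ (a * β * θ)) : ℤ)) := by
  have ha' : (a : K) ≠ 0 := by simpa using ha
  have hβ' : (β : K) ≠ 0 := by simpa using hβ
  have hcross {x y : K} (hx : x ∈ divSub β) (hy : y ∈ dualSub (2 * a * θ)) :
      traceChar (2 * (a * β * θ) * x) y = 1 := by
    rw [traceChar_congr (show 2 * (a * β * θ) * x * y = 2 * a * θ * (y * (β * x)) by ring)]
    obtain ⟨z, hz⟩ := mem_divSub.1 hx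
    rw [← hz]
    exact hy z
  have hdiv {x : K} (hx : x ∈ divSub β) (hx' : ((2 * a * c : 𝓞 K) : K) * x ∈ intSub K) :
      x ∈ intSub K := by
    obtain ⟨p, q, hpq⟩ := hcop
    have := (intSub K).add_mem (mul_mem_intSub (coe_mem_intSub p) (mem_divSub.1 hx))
      (mul_mem_intSub (coe_mem_intSub q) hx')
    rwa [← mul_assoc, ← mul_assoc, ← map_mul, ← map_mul, ← add_mul, ← map_add, hpq, map_one,
      one_mul] at this
  have hmem {x : K} : x ∈ dualSub (2 * (a * β * θ)) ↔ β * x ∈ dualSub (2 * a * θ) :=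
    forall_congr' fun y => by
      rw [traceChar_congr (show 2 * (a * β * θ) * (x * y) = 2 * a * θ * (β * x * y) by ring)]
  have hsys : IsCosetSystem (dualSub (2 * (a * β * θ))) (intSub K)
      fun p : ι × κ => (r p.1 : K) / β + s p.2 := by
    refine (isCosetSystem_divSub hβ hr).add hs (fun x hx => ?_) (fun x hx => ?_) (fun x hx => ?_)
      (fun x hx hx' => hdiv hx (mul_mem_intSub_of_mem_dualSub hdual hx')) (intSub_le_dualSub h1)
    · exact hmem.2 (intSub_le_dualSub h1 hx)
    · rw [hmem, mul_comm (β : K)]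
      exact mul_mem_dualSub hx (coe_mem_intSub β)
    · rw [hmem] at hx
      obtain ⟨p, q, hpq⟩ := hcop
      refine ⟨((q * (2 * a * c) : 𝓞 K) : K) * x, ?_, ((p * β : 𝓞 K) : K) * x, ?_, ?_⟩
      · have := mul_mem_intSub (coe_mem_intSub q) (mul_mem_intSub_of_mem_dualSub hdual hx)
        rw [mem_divSub]
        convert this using 1
        simp only [map_mul]
        ring
      · have := mul_mem_dualSub hx (coe_mem_intSub p)
        convert this using 1
        simp only [map_mul]
        ring
      · rw [← add_mul, ← map_add, add_comm, hpq, map_one, one_mul]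
  obtain ⟨t, ht, h⟩ := exists_sum_traceChar_sq_eq (a * β * θ)
    (mul_ne_zero (mul_ne_zero ha' hβ') hθ) (fun y => by
      rw [← h1 (a * β * y)]
      refine traceChar_congr ?_
      simp only [map_mul]
      ring) hsys
  refine ⟨t, ht, h ▸ ?_⟩
  rw [Fintype.sum_prod_type, Finset.sum_mul_sum]
  refine Finset.sum_congr rfl fun i _ => Finset.sum_congr rfl fun j _ => ?_
  rw [traceChar_add_sq, hcross ((isCosetSystem_divSub hβ hr).mem i) (hs.mem j), mul_one]
  congr 1
  refine traceChar_congr ?_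
  field_simp

theorem sum_traceChar_sq_congr {a c β δ : 𝓞 K} {θ : K}
    (hdual : ∀ x : K, (∀ y : 𝓞 K, traceChar θ (x * y) = 1) → (c : K) * x ∈ intSub K)
    (h : 4 * a * c ∣ β - δ) {κ : Type*} [Fintype κ] {s : κ → K}
    (hs : IsCosetSystem (dualSub (2 * a * θ)) (intSub K) s) :
    ∑ j, traceChar (a * β * θ) (s j ^ 2) = ∑ j, traceChar (a * δ * θ) (s j ^ 2) := by
  refine Finset.sum_congr rfl fun j _ => ?_
  obtain ⟨k, hk⟩ := h
  obtain ⟨z, hz⟩ := mem_intSub.1 (mul_mem_intSub_of_mem_dualSub hdual (hs.mem j))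
  obtain rfl := sub_eq_iff_eq_add.1 hk
  have := hs.mem j (z * k)
  rw [show s j * (z * k : 𝓞 K) = s j * (z * k) by rw [ringOfIntegers_coe_mul], hz] at this
  rw [← one_mul (traceChar (a * δ * θ) _), ← this, traceChar_apply, traceChar_apply,
    traceChar_apply, ← AddChar.map_add_eq_mul, ← map_add]
  congr 2
  simp only [map_mul, map_add, map_ofNat]
  ring

theorem eq_of_mul_eq_mul_of_mem_mrange {m n : ℤ}
    (hm : m ∈ MonoidHom.mrange (SignType.castHom (α := ℤ)))
    (hn : n ∈ MonoidHom.mrange (SignType.castHom (α := ℤ))) {x y : ℝ} (hx : 0 < x) (hy : 0 < y)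
    (h : m * x = n * y) : m = n := by
  obtain ⟨m, rfl⟩ := hm
  obtain ⟨n, rfl⟩ := hn
  cases m <;> cases n <;> simp at h ⊢ <;> linarith

/-- Invariance of the completed symbol modulo `8αc`, where `c` is any element killing
the quotient by `𝓞` of its dual for `Tr (θxy)`. -/
theorem muInf_mul_quadSym_eq {α c β δ : 𝓞 K} (hα : α ≠ 0) (hc : c ≠ 0) (hβ : β ≠ 0) (hδ : δ ≠ 0)
    {θ : K} (hθ : θ ≠ 0) (h1 : ∀ y : 𝓞 K, traceChar θ y = 1)
    (hdual : ∀ x : K, (∀ y : 𝓞 K, traceChar θ (x * y) = 1) → (c : K) * x ∈ intSub K)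
    (hβcop : IsCoprime β (2 * α * c)) (hδcop : IsCoprime δ (2 * α * c))
    (h : 8 * α * c ∣ β - δ) :
    muInf α β * quadSym (Ideal.span {β}) α = muInf α δ * quadSym (Ideal.span {δ}) α := by
  obtain ⟨κ, _, s, hs⟩ := exists_isCosetSystem_dualSub (a := 1) one_ne_zero hc h1 hdual
  obtain ⟨κ', _, s', hs'⟩ := exists_isCosetSystem_dualSub hα hc h1 hdual
  have hD := sum_traceChar_sq_congr hdual (Dvd.dvd.trans ⟨2 * α, by ring⟩ h) hs
  have hD' := sum_traceChar_sq_congr hdual (Dvd.dvd.trans ⟨2, by ring⟩ h) hs'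
  have key {γ : 𝓞 K} (hγ : γ ≠ 0) (hcop : IsCoprime γ (2 * α * c)) :
      ∃ t t' : ℝ, 0 < t ∧ 0 < t' ∧ (∑ j, traceChar (α * γ * θ) (s' j ^ 2)) ≠ 0 ∧
        (muInf α γ * quadSym (Ideal.span {γ}) α : ℂ) * t *
            (∑ j, traceChar (α * γ * θ) (s' j ^ 2)) *
          zetaEight ^ (∑ φ : K →+* ℝ, (SignType.sign (φ θ) : ℤ)) =
        t' * (∑ j, traceChar ((1 : 𝓞 K) * γ * θ) (s j ^ 2)) *
          zetaEight ^ (∑ φ : K →+* ℝ, (SignType.sign (φ (α * θ)) : ℤ)) := by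
    obtain ⟨ι, _, r, hr⟩ := exists_isCosetSystem_ideal (⊤ : Ideal (𝓞 K))
      (J := Ideal.span {γ}) (by simpa using hγ)
    have hcop₁ : IsCoprime γ (2 * 1 * c) :=
      hcop.of_isCoprime_of_dvd_right ⟨α, by ring⟩
    obtain ⟨t', ht', e'⟩ := exists_sum_mul_sum_eq hα hγ hθ h1 hdual hcop hr hs'
    obtain ⟨t, ht, e⟩ := exists_sum_mul_sum_eq one_ne_zero hγ hθ h1 hdual hcop₁ hr hs
    have hsign := sum_sign_mul_mul hα hγ hθ
    have hζ (n : ℤ) : zetaEight ^ n ≠ 0 := zpow_ne_zero n zetaEight_ne_zero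
    have hG : ∑ i, traceChar (θ / γ) (α * r i ^ 2) =
        quadSym (Ideal.span {γ}) α * ∑ i, traceChar (θ / γ) ((1 : 𝓞 K) * r i ^ 2) := by
      have hγ' : (γ : K) ≠ 0 := by simpa using hγ
      have hψ : IsPerfectOn ((traceChar (θ / γ)).compAddMonoidHom
          (algebraMap (𝓞 K) K).toAddMonoidHom) ⊤ (Ideal.span {γ}) := by
        intro x _
        have hval (y : 𝓞 K) : (traceChar (θ / γ)).compAddMonoidHom
            (algebraMap (𝓞 K) K).toAddMonoidHom (x * y) = traceChar θ (x / γ * y) := by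
          refine traceChar_congr (θ := θ / γ) ?_
          show θ / γ * algebraMap (𝓞 K) K (x * y) = _
          rw [map_mul]
          ring
        rw [← Ideal.one_eq_top, one_pow, one_mul, Ideal.mem_span_singleton]
        simp only [hval]
        constructor
        · intro h
          obtain ⟨y, hy⟩ := mem_intSub.1 (hdual _ h)
          refine (hcop.of_isCoprime_of_dvd_right (Dvd.intro_left _ rfl)).dvd_of_dvd_mul_left
            (⟨y, RingOfIntegers.ext ?_⟩ : γ ∣ c * x)
          rw [ringOfIntegers_coe_mul, ringOfIntegers_coe_mul, hy]
          field_simp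
        · rintro ⟨y, rfl⟩ z
          rw [← h1 (y * z), ringOfIntegers_coe_mul, ringOfIntegers_coe_mul, mul_div_cancel_left₀ _ hγ']
      rw [← Ideal.top_mul (Ideal.span {γ})] at hr
      have := sum_mul_sq_eq_mul_sum (by simpa using hγ) ?_ ?_ (by simp) hψ hr (α := α)
      · convert this using 2
        · refine congrArg (traceChar (θ / γ)) ?_
          simp
        · refine Finset.sum_congr rfl fun i _ => congrArg (traceChar (θ / γ)) ?_
          simp
      · exact (Ideal.isCoprime_span_singleton_iff _ _).2
          (hcop.of_isCoprime_of_dvd_right ⟨α * c, by ring⟩)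
      · exact (Ideal.isCoprime_span_singleton_iff _ _).2
          (hcop.of_isCoprime_of_dvd_right ⟨2 * c, by ring⟩)
    refine ⟨t, t', ht, ht', fun h0 => ?_, mul_left_cancel₀
      (hζ (∑ φ : K →+* ℝ, (SignType.sign (φ (α * γ * θ)) : ℤ))) ?_⟩
    · rw [h0, mul_zero, eq_comm, mul_eq_zero] at e'
      exact e'.elim (by exact_mod_cast ht'.ne') (hζ _)
    · rw [hG] at e'
      simp only [map_one, one_mul] at e e' ⊢
      generalize zetaEight ^ (∑ φ : K →+* ℝ, (SignType.sign (φ (α * γ * θ)) : ℤ)) = A at *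
      linear_combination (-(quadSym (Ideal.span {γ}) α * t *
          ∑ j, traceChar (α * γ * θ) (s' j ^ 2))) * hsign -
        (quadSym (Ideal.span {γ}) α * (∑ j, traceChar (α * γ * θ) (s' j ^ 2)) *
          zetaEight ^ (∑ φ : K →+* ℝ, (SignType.sign (φ (α * θ)) : ℤ))) * e +
        ((∑ j, traceChar (γ * θ) (s j ^ 2)) *
          zetaEight ^ (∑ φ : K →+* ℝ, (SignType.sign (φ (α * θ)) : ℤ))) * e'
  obtain ⟨t, t', ht, ht', hne, e⟩ := key hβ hβcop
  obtain ⟨p, p', hp, hp', -, e'⟩ := key hδ hδcop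
  rw [hD, hD'] at e
  rw [hD'] at hne
  have hX : (∑ j, traceChar (α * δ * θ) (s' j ^ 2)) *
      zetaEight ^ (∑ φ : K →+* ℝ, (SignType.sign (φ θ) : ℤ)) ≠ 0 :=
    mul_ne_zero hne (zpow_ne_zero _ zetaEight_ne_zero)
  refine eq_of_mul_eq_mul_of_mem_mrange (muInf_mul_quadSym_mem α β) (muInf_mul_quadSym_mem α δ)
    (mul_pos ht hp') (mul_pos ht' hp) ?_
  have : (muInf α β * quadSym (Ideal.span {β}) α * (t * p') : ℂ) =
      muInf α δ * quadSym (Ideal.span {δ}) α * (t' * p) :=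
    mul_left_cancel₀ hX (by linear_combination (p' : ℂ) * e - (t' : ℂ) * e')
  exact_mod_cast this

theorem not_isUnit_two_ringOfIntegers : ¬ IsUnit (2 : 𝓞 K) := by
  intro h
  have h2 := h.map (Algebra.norm ℤ)
  rw [show (2 : 𝓞 K) = algebraMap ℤ (𝓞 K) 2 by simp, Algebra.norm_algebraMap,
    isUnit_pow_iff (Module.finrank_pos (R := ℤ) (M := 𝓞 K)).ne', Int.isUnit_iff] at h2
  omega

theorem traceChar_mul_eq_one_iff_mem_dual (θ x : K) :
    (∀ y : 𝓞 K, traceChar θ (x * y) = 1) ↔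
      θ * x ∈ FractionalIdeal.dual ℤ ℚ (1 : FractionalIdeal (nonZeroDivisors (𝓞 K)) K) := by
  rw [FractionalIdeal.mem_dual (one_ne_zero' (FractionalIdeal (nonZeroDivisors (𝓞 K)) K))]
  simp only [FractionalIdeal.mem_one_iff, forall_exists_index, forall_apply_eq_imp_iff,
    traceChar_apply, ratExp_eq_one_iff, Algebra.traceForm_apply, RingHom.mem_range,
    eq_intCast, ← mul_assoc]
  exact forall_congr' fun y => exists_congr fun n => eq_comm

/-- A local generator of the inverse different at the primes dividing `b`. -/
theorem exists_traceChar_perfect_away {b : 𝓞 K} (hb : b ≠ 0) :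
    ∃ (θ : K) (c : 𝓞 K), θ ≠ 0 ∧ c ≠ 0 ∧ (∀ y : 𝓞 K, traceChar θ y = 1) ∧
      (∀ x : K, (∀ y : 𝓞 K, traceChar θ (x * y) = 1) → (c : K) * x ∈ intSub K) ∧
      IsCoprime (2 * b) c := by
  set I := FractionalIdeal.dual ℤ ℚ (1 : FractionalIdeal (nonZeroDivisors (𝓞 K)) K) with hI
  have hI0 : I ≠ 0 := FractionalIdeal.dual_ne_zero _ _ one_ne_zero
  have h2b : (2 * b : 𝓞 K) ≠ 0 := mul_ne_zero two_ne_zero hb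
  have hspan : FractionalIdeal.spanSingleton (nonZeroDivisors (𝓞 K)) ((2 * b : 𝓞 K) : K) ≤ 1 := by
    rw [FractionalIdeal.spanSingleton_le_iff_mem, FractionalIdeal.mem_one_iff]
    exact ⟨_, rfl⟩
  obtain ⟨θ, hθ⟩ := IsDedekindDomain.exists_add_spanSingleton_mul_eq hspan
    (by rw [ne_eq, FractionalIdeal.spanSingleton_eq_zero_iff]; exact_mod_cast h2b)
    (inv_ne_zero hI0)
  have hle : FractionalIdeal.spanSingleton (nonZeroDivisors (𝓞 K)) θ * I⁻¹ ≤ 1 :=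
    hθ ▸ le_add_of_nonneg_left zero_le
  have hθI : θ ∈ I := by
    have := mul_le_mul_left hle I
    rwa [mul_assoc, inv_mul_cancel₀ hI0, mul_one, one_mul,
      FractionalIdeal.spanSingleton_le_iff_mem] at this
  have h1 : (1 : K) ∈ (1 : FractionalIdeal (nonZeroDivisors (𝓞 K)) K) :=
    FractionalIdeal.one_mem_one _
  rw [← hθ, ← FractionalIdeal.mem_coe, FractionalIdeal.coe_add, Submodule.add_eq_sup,
    Submodule.mem_sup] at h1
  obtain ⟨u, hu, w, hw, huw⟩ := h1
  rw [FractionalIdeal.mem_coe, FractionalIdeal.mem_spanSingleton] at hu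
  obtain ⟨z, rfl⟩ := hu
  rw [FractionalIdeal.mem_coe] at hw
  obtain ⟨c, rfl⟩ := (FractionalIdeal.mem_one_iff _).1 (hle hw)
  have hzc : z * (2 * b) + 1 * c = 1 := by
    refine FaithfulSMul.algebraMap_injective (𝓞 K) K ?_
    rw [map_add, map_mul, map_one, one_mul, ← huw, Algebra.smul_def]
  have hc : c ≠ 0 := by
    rintro rfl
    refine not_isUnit_two_ringOfIntegers (K := K) (.of_mul_eq_one (z * b) ?_)
    rw [← hzc]
    ring
  refine ⟨θ, c, ?_, hc, fun y => ?_, fun x hx => ?_, ⟨z, 1, hzc⟩⟩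
  · rintro rfl
    rw [FractionalIdeal.spanSingleton_zero, zero_mul, FractionalIdeal.mem_zero_iff] at hw
    exact hc (by simpa using hw)
  · have := (traceChar_mul_eq_one_iff_mem_dual θ 1).2 (by simpa using hθI) y
    rwa [one_mul] at this
  · rw [traceChar_mul_eq_one_iff_mem_dual, ← hI] at hx
    have hmem : (c : K) * x ∈ (1 : FractionalIdeal (nonZeroDivisors (𝓞 K)) K) := by
      obtain ⟨v, hv, hcv⟩ := FractionalIdeal.mem_singleton_mul.1 hw
      have := FractionalIdeal.mul_mem_mul hx hv
      rw [mul_inv_cancel₀ hI0] at this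
      convert this using 1
      change algebraMap (𝓞 K) K c * x = _
      rw [hcv]
      ring
    exact mem_intSub.2 ((FractionalIdeal.mem_one_iff _).1 hmem)

theorem quadSym_eq_zero {α β : 𝓞 K} (hβ : β ≠ 0) (h : ¬ IsCoprime β α) :
    quadSym (Ideal.span {β}) α = 0 := by
  rw [← Ideal.isCoprime_span_singleton_iff, Ideal.isCoprime_iff_sup_eq] at h
  obtain ⟨𝔭, h𝔭, hle⟩ := Ideal.exists_le_maximal _ h
  have hβ𝔭 : β ∈ 𝔭 := hle (Ideal.mem_sup_left (Ideal.mem_span_singleton_self β))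
  have hα𝔭 : α ∈ 𝔭 := hle (Ideal.mem_sup_right (Ideal.mem_span_singleton_self α))
  obtain ⟨J, hJ⟩ := Ideal.dvd_iff_le.2 ((Ideal.span_singleton_le_iff_mem _).2 hβ𝔭)
  have hβ' : 𝔭 * J ≠ 0 := hJ ▸ by simpa using hβ
  have h𝔭0 := left_ne_zero_of_mul hβ'
  have := h𝔭.isPrime
  rw [hJ, quadSym_mul h𝔭0 (right_ne_zero_of_mul hβ'), quadSym_prime h𝔭0, legSym,
    if_pos (Ideal.Quotient.eq_zero_iff_mem.2 hα𝔭), zero_mul]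

theorem ne_zero_of_isCoprime_two {β : 𝓞 K} (h : IsCoprime β 2) : β ≠ 0 := by
  rintro rfl
  exact not_isUnit_two_ringOfIntegers (isCoprime_zero_left.1 h)

theorem IsCoprime.of_dvd_sub {R : Type*} [CommRing R] {x y m : R} (h : IsCoprime x m)
    (hxy : m ∣ x - y) : IsCoprime y m := by
  obtain ⟨k, hk⟩ := hxy
  rw [show y = x + m * -k by linear_combination -hk]
  exact h.add_mul_left_left _

theorem completed_quadSym_eq {α β δ : 𝓞 K} (hα : α ≠ 0) (hβ : IsCoprime β 2)
    (hδ : IsCoprime δ 2) (h : 8 * α ∣ β - δ) :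
    muInf α β * quadSym (Ideal.span {β}) α = muInf α δ * quadSym (Ideal.span {δ}) α := by
  have hβ0 := ne_zero_of_isCoprime_two hβ
  have hδ0 := ne_zero_of_isCoprime_two hδ
  have hαdvd : α ∣ β - δ := (Dvd.intro_left _ rfl).trans h
  by_cases hβα : IsCoprime β α
  swap
  · have hδα : ¬ IsCoprime δ α := fun h' => hβα (h'.of_dvd_sub (dvd_sub_comm.1 hαdvd))
    rw [quadSym_eq_zero hβ0 hβα, quadSym_eq_zero hδ0 hδα, mul_zero, mul_zero]
  have hδα : IsCoprime δ α := hβα.of_dvd_sub hαdvd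
  obtain ⟨θ₁, c₁, hθ₁, hc₁, h1₁, hd₁, hcop₁⟩ := exists_traceChar_perfect_away hβ0
  obtain ⟨θ₂, c₂, hθ₂, hc₂, h1₂, hd₂, hcop₂⟩ :=
    exists_traceChar_perfect_away (mul_ne_zero hδ0 hc₁)
  have hβc₁ : IsCoprime β c₁ := hcop₁.of_mul_left_right
  have hδc₂ : IsCoprime δ c₂ := hcop₂.of_mul_left_right.of_mul_left_left
  obtain ⟨k, hk⟩ := h
  obtain ⟨a, b, hab⟩ : IsCoprime c₁ c₂ := hcop₂.of_mul_left_right.of_mul_left_right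
  have hβγ : β - (β - 8 * α * k * a * c₁) = 8 * α * c₁ * (k * a) := by ring
  have hγδ : β - 8 * α * k * a * c₁ - δ = 8 * α * c₂ * (k * b) := by
    linear_combination hk - 8 * α * k * hab
  generalize β - 8 * α * k * a * c₁ = γ at hβγ hγδ
  have hγ : IsCoprime γ 2 := hβ.of_dvd_sub ⟨4 * α * c₁ * (k * a), by rw [hβγ]; ring⟩
  have hγα : IsCoprime γ α := hβα.of_dvd_sub ⟨8 * c₁ * (k * a), by rw [hβγ]; ring⟩
  have hγc₁ : IsCoprime γ c₁ := hβc₁.of_dvd_sub ⟨8 * α * (k * a), by rw [hβγ]; ring⟩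
  have hγc₂ : IsCoprime γ c₂ := hδc₂.of_dvd_sub
    (dvd_sub_comm.1 ⟨8 * α * (k * b), by rw [hγδ]; ring⟩)
  have hγ0 := ne_zero_of_isCoprime_two hγ
  exact (muInf_mul_quadSym_eq hα hc₁ hβ0 hγ0 hθ₁ h1₁ hd₁ ((hβ.mul_right hβα).mul_right hβc₁)
      ((hγ.mul_right hγα).mul_right hγc₁) ⟨_, hβγ⟩).trans
    (muInf_mul_quadSym_eq hα hc₂ hγ0 hδ0 hθ₂ h1₂ hd₂ ((hγ.mul_right hγα).mul_right hγc₂)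
      ((hδ.mul_right hδα).mul_right hδc₂) ⟨_, hγδ⟩)

theorem TotPos.muInf_eq_one {K : Type*} [Field K] {β : 𝓞 K} (h : TotPos β) (α : 𝓞 K) :
    muInf α β = 1 :=
  finprod_eq_one_of_forall_eq_one fun v => if_neg fun hv => (h v).not_gt hv.2

/-- **Proposition 2.2** (Friedlander–Iwaniec–Mazur–Rubin, "The spin of prime ideals").
For fixed nonzero `α ∈ 𝓞 K`, the completed quadratic residue symbol
`|α/β| = μ_∞(α,β)(α/β)` depends, for odd `β`, only on the residue class of `β`
modulo `(8α)`; the same holds for `(α/β)` for odd totally positive `β`. -/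
theorem spins_of_prime_ideals_stmt12
    (K : Type*) [Field K] [NumberField K]
    (α : 𝓞 K) (hα : α ≠ 0) :
    (∀ β δ : 𝓞 K,
      IsCoprime (Ideal.span {β}) (Ideal.span {(2 : 𝓞 K)}) →
      IsCoprime (Ideal.span {δ}) (Ideal.span {(2 : 𝓞 K)}) →
      β - δ ∈ Ideal.span {8 * α} →
      muInf α β * quadSym (Ideal.span {β}) α =
        muInf α δ * quadSym (Ideal.span {δ}) α) ∧
    (∀ β δ : 𝓞 K,
      IsCoprime (Ideal.span {β}) (Ideal.span {(2 : 𝓞 K)}) →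
      IsCoprime (Ideal.span {δ}) (Ideal.span {(2 : 𝓞 K)}) →
      TotPos β → TotPos δ →
      β - δ ∈ Ideal.span {8 * α} →
      quadSym (Ideal.span {β}) α = quadSym (Ideal.span {δ}) α) := by
  simp only [Ideal.isCoprime_span_singleton_iff, Ideal.mem_span_singleton]
  refine ⟨fun β δ hβ hδ h => completed_quadSym_eq hα hβ hδ h, fun β δ hβ hδ hβpos hδpos h => ?_⟩
  simpa only [hβpos.muInf_eq_one, hδpos.muInf_eq_one, one_mul] using
    completed_quadSym_eq hα hβ hδ h

end
end

section
/- Let K be a number field with ring of integers 𝓞 and let 𝔮 be an odd nonzero integral ideal whose absolute norm q = N𝔮 is not squarefull, i.e. there exists a rational prime p with p ∣ q and p² ∤ q. Then the function χ_𝔮 : ℤ → {0, ±1} defined by χ_𝔮(ℓ) = (ℓ/𝔮), which is periodic of period q and completely multiplicative, is not the principal character modulo q: there exists ℓ ∈ ℤ with gcd(ℓ, q) = 1 and χ_𝔮(ℓ) = −1. -/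
set_option synthInstance.maxHeartbeats 1000000
set_option maxHeartbeats 2000000

open NumberField
open scoped Classical

noncomputable section

variable {K : Type*} [Field K] [NumberField K]

theorem legSym_eq_one_of_sub_one_mem {F : Type*} [Field F] (𝔭 : Ideal (𝓞 F)) (h𝔭 : 𝔭 ≠ ⊤)
    {α : 𝓞 F} (hα : α - 1 ∈ 𝔭) : legSym 𝔭 α = 1 := by
  have : Ideal.Quotient.mk 𝔭 α = 1 := by
    rw [← map_one (Ideal.Quotient.mk 𝔭)]
    exact Ideal.Quotient.eq.mpr hα
  have : Nontrivial (𝓞 F ⧸ 𝔭) := Ideal.Quotient.nontrivial_iff.mpr h𝔭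
  simp [legSym, *]

theorem legSym_intCast_eq_neg_one (𝔭 : Ideal (𝓞 K)) {p : ℕ} (hp : p.Prime)
    (h𝔭 : Ideal.absNorm 𝔭 = p) {ℓ : ℤ} (hℓ : ¬ IsSquare (ℓ : ZMod p)) :
    legSym 𝔭 (ℓ : 𝓞 K) = -1 := by
  have : Finite (𝓞 K ⧸ 𝔭) :=
    (Ideal.absNorm_ne_zero_iff 𝔭).mp (h𝔭 ▸ hp.ne_zero)
  have : Fintype (𝓞 K ⧸ 𝔭) := Fintype.ofFinite _
  have hcard : Fintype.card (𝓞 K ⧸ 𝔭) = p := by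
    rw [← h𝔭, Ideal.absNorm_apply, Submodule.cardQuot_apply, ← Nat.card_eq_fintype_card]
  let e := ZMod.ringEquivOfPrime (𝓞 K ⧸ 𝔭) hp hcard
  have hmk : e.symm (Ideal.Quotient.mk 𝔭 (ℓ : 𝓞 K)) = (ℓ : ZMod p) := by
    rw [map_intCast, map_intCast]
  have hsq : ¬ IsSquare (Ideal.Quotient.mk 𝔭 (ℓ : 𝓞 K)) := fun h ↦
    hℓ (hmk ▸ h.map e.symm)
  have h0 : Ideal.Quotient.mk 𝔭 (ℓ : 𝓞 K) ≠ 0 := fun h ↦ hsq (h ▸ IsSquare.zero)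
  rw [legSym, if_neg h0, if_neg hsq]

theorem exists_int_not_isSquare_and_modEq_one {p m : ℕ} (hp : p.Prime) (hp2 : p ≠ 2)
    (hpm : p.Coprime m) :
    ∃ ℓ : ℤ, ¬ IsSquare (ℓ : ZMod p) ∧ (m : ℤ) ∣ ℓ - 1 ∧ IsCoprime ℓ ((p * m : ℕ) : ℤ) := by
  have : Fact p.Prime := ⟨hp⟩
  obtain ⟨a, ha⟩ := FiniteField.exists_nonsquare (F := ZMod p)
    (by rwa [ZMod.ringChar_zmod_n])
  obtain ⟨n, hn1, hn2⟩ := Nat.chineseRemainder hpm a.val 1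
  have hna : ((n : ℤ) : ZMod p) = a := by
    rw [Int.cast_natCast, (ZMod.natCast_eq_natCast_iff _ _ _).mpr hn1, ZMod.natCast_zmod_val]
  refine ⟨n, by rwa [hna], ?_, ?_⟩
  · exact_mod_cast (Nat.modEq_iff_dvd.mp hn2.symm)
  · refine Nat.isCoprime_iff_coprime.mpr (Nat.Coprime.mul_right ?_ ?_)
    · refine ((Nat.Prime.coprime_iff_not_dvd hp).mpr fun h ↦ ha ?_).symm
      rw [← hna, Int.cast_natCast, (ZMod.natCast_eq_zero_iff _ _).mpr h]
      exact IsSquare.zero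
    · rw [Nat.Coprime, hn2.gcd_eq, Nat.gcd_one_left]

theorem Ideal.absNorm_eq_of_dvd_of_not_sq_dvd (𝔭 : Ideal (𝓞 K)) [𝔭.IsMaximal] {p : ℕ}
    (hp : p.Prime) (hdvd : p ∣ Ideal.absNorm 𝔭) (hsq : ¬ p ^ 2 ∣ Ideal.absNorm 𝔭) :
    Ideal.absNorm 𝔭 = p := by
  obtain ⟨r, n, hn, -, hr, h⟩ := Ideal.exists_prime_and_absNorm_eq_pow 𝔭
  rw [h] at hdvd hsq ⊢
  obtain rfl := (Nat.prime_dvd_prime_iff_eq hp hr).mp (hp.dvd_of_dvd_pow hdvd)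
  obtain rfl : n = 1 := by
    by_contra hn1
    exact hsq (pow_dvd_pow p (by omega))
  exact pow_one p

open UniqueFactorizationMonoid in
/-- If a prime `p` divides `N𝔮` exactly once, then `𝔮` has a prime factor of norm `p` and the
product of the norms of the remaining factors is coprime to `p`. -/
theorem Ideal.exists_normalizedFactors_eq_cons (𝔮 : Ideal (𝓞 K)) (h𝔮 : 𝔮 ≠ ⊥) {p : ℕ}
    (hp : p.Prime) (hdvd : p ∣ Ideal.absNorm 𝔮) (hsq : ¬ p ^ 2 ∣ Ideal.absNorm 𝔮) :
    ∃ (𝔭 : Ideal (𝓞 K)) (s : Multiset (Ideal (𝓞 K))), normalizedFactors 𝔮 = 𝔭 ::ₘ s ∧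
      Ideal.absNorm 𝔭 = p ∧ Ideal.absNorm 𝔮 = p * (s.map Ideal.absNorm).prod ∧
      p.Coprime (s.map Ideal.absNorm).prod := by
  have hprod : Ideal.absNorm 𝔮 = ((normalizedFactors 𝔮).map Ideal.absNorm).prod := by
    rw [← map_multiset_prod, Ideal.prod_normalizedFactors_eq_self h𝔮]
  obtain ⟨𝔭, h𝔭, hp𝔭⟩ := hp.prime.exists_mem_multiset_map_dvd (hprod ▸ hdvd)
  obtain ⟨s, hs⟩ := Multiset.exists_cons_of_mem h𝔭
  have h𝔭prime := prime_of_normalized_factor 𝔭 h𝔭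
  have : 𝔭.IsMaximal := (Ideal.isPrime_of_prime h𝔭prime).isMaximal h𝔭prime.ne_zero
  rw [hs, Multiset.map_cons, Multiset.prod_cons] at hprod
  have h𝔭p : Ideal.absNorm 𝔭 = p := Ideal.absNorm_eq_of_dvd_of_not_sq_dvd 𝔭 hp hp𝔭
    fun h ↦ hsq (hprod ▸ h.mul_right _)
  rw [h𝔭p] at hprod
  refine ⟨𝔭, s, hs, h𝔭p, hprod, (Nat.Prime.coprime_iff_not_dvd hp).mpr fun h ↦ hsq ?_⟩
  rw [hprod, sq]
  exact mul_dvd_mul_left p h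

/-- **Lemma 2.6** (Friedlander–Iwaniec–Mazur–Rubin, "The spin of prime ideals").
Let `𝔮` be an odd nonzero ideal of `𝓞 K` whose norm `q = N𝔮` is not squarefull, i.e.
some rational prime divides `q` exactly once.  Then the real Dirichlet character
`χ_𝔮(ℓ) = (ℓ/𝔮)` on `ℤ` is not principal: there is `ℓ` coprime to `q` with
`χ_𝔮(ℓ) = -1`. -/
theorem spins_of_prime_ideals_stmt16
    (K : Type*) [Field K] [NumberField K]
    (𝔮 : Ideal (𝓞 K)) (h𝔮bot : 𝔮 ≠ ⊥)
    (h𝔮odd : IsCoprime 𝔮 (Ideal.span {(2 : 𝓞 K)}))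
    (p : ℕ) (hp : p.Prime)
    (hpdvd : p ∣ Ideal.absNorm 𝔮) (hpsq : ¬ p ^ 2 ∣ Ideal.absNorm 𝔮) :
    ∃ ℓ : ℤ, IsCoprime ℓ (Ideal.absNorm 𝔮 : ℤ) ∧ quadSym 𝔮 (ℓ : 𝓞 K) = -1 := by
  obtain ⟨𝔭, s, hs, h𝔭p, hnorm, hcop⟩ :=
    Ideal.exists_normalizedFactors_eq_cons 𝔮 h𝔮bot hp hpdvd hpsq
  have hprime : ∀ 𝔯 ∈ 𝔭 ::ₘ s, Prime 𝔯 := fun 𝔯 h ↦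
    UniqueFactorizationMonoid.prime_of_normalized_factor 𝔯 (hs ▸ h)
  have h𝔮𝔭 : 𝔮 ≤ 𝔭 := Ideal.le_of_dvd <|
    UniqueFactorizationMonoid.dvd_of_mem_normalizedFactors (hs ▸ Multiset.mem_cons_self 𝔭 s)
  have hp2 : p ≠ 2 := by
    rintro rfl
    have h2 : (2 : 𝓞 K) ∈ 𝔭 := by simpa [h𝔭p] using Ideal.absNorm_mem 𝔭
    refine (Ideal.isPrime_of_prime (hprime 𝔭 (Multiset.mem_cons_self 𝔭 s))).ne_top ?_
    rw [eq_top_iff, ← Ideal.isCoprime_iff_sup_eq.mp h𝔮odd]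
    exact sup_le h𝔮𝔭 ((Ideal.span_singleton_le_iff_mem 𝔭).mpr h2)
  obtain ⟨ℓ, hℓsq, hℓ1, hℓcop⟩ := exists_int_not_isSquare_and_modEq_one hp hp2 hcop
  refine ⟨ℓ, hnorm ▸ hℓcop, ?_⟩
  have hrest : (s.map fun 𝔯 ↦ legSym 𝔯 (ℓ : 𝓞 K)).prod = 1 := by
    refine Multiset.prod_eq_one fun x hx ↦ ?_
    obtain ⟨𝔯, h𝔯, rfl⟩ := Multiset.mem_map.mp hx
    refine legSym_eq_one_of_sub_one_mem 𝔯
      (Ideal.isPrime_of_prime (hprime 𝔯 (Multiset.mem_cons_of_mem h𝔯))).ne_top ?_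
    obtain ⟨c, hc⟩ : (Ideal.absNorm 𝔯 : ℤ) ∣ ℓ - 1 :=
      (Int.natCast_dvd_natCast.mpr
        (Multiset.dvd_prod (Multiset.mem_map_of_mem Ideal.absNorm h𝔯))).trans hℓ1
    have hc' : (ℓ : 𝓞 K) - 1 = (Ideal.absNorm 𝔯 : 𝓞 K) * c := by
      exact_mod_cast congrArg (Int.cast : ℤ → 𝓞 K) hc
    exact hc' ▸ Ideal.mul_mem_right _ _ (Ideal.absNorm_mem 𝔯)
  rw [quadSym, hs, Multiset.map_cons, Multiset.prod_cons, hrest, mul_one,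
    legSym_intCast_eq_neg_one 𝔭 hp h𝔭p hℓsq]

end
end

section
/- Let K be a totally real number field of degree n ≥ 2 with ring of integers 𝓞. Then there exist a totally positive unit u ∈ 𝓞^× and a real embedding v₀ of K such that v(u) ≤ 1/2 for every real embedding v of K with v ≠ v₀. -/
set_option synthInstance.maxHeartbeats 1000000
set_option maxHeartbeats 2000000

open NumberField

theorem NumberField.mk_ofReal_comp_injective (K : Type*) [Field K] :
    Function.Injective fun v : K →+* ℝ ↦ InfinitePlace.mk (Complex.ofRealHom.comp v) := by
  intro v v' h
  have key : Complex.ofRealHom.comp v = Complex.ofRealHom.comp v' := by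
    rcases InfinitePlace.mk_eq_iff.mp h with h | h
    · exact h
    · rw [← h]
      ext x
      simp [ComplexEmbedding.conjugate_coe_eq]
  ext x
  exact Complex.ofReal_injective (RingHom.congr_fun key x)

/-- **Lemma 2.2** (Friedlander–Iwaniec–Mazur–Rubin, "The spin of prime ideals").
Let `K` be a totally real number field of degree `n ≥ 2`.  Then there is a totally
positive unit `u` all but one of whose (real) conjugates are `≤ 1/2`. -/
theorem spins_of_prime_ideals_stmt17
    (n : ℕ) (hn : 2 ≤ n)
    (K : Type*) [Field K] [NumberField K]
    (hdeg : Module.finrank ℚ K = n)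
    (htotreal : ∀ φ : K →+* ℂ, ComplexEmbedding.IsReal φ) :
    ∃ u : (𝓞 K)ˣ, (∀ v : K →+* ℝ, 0 < v ((u : 𝓞 K) : K)) ∧
      ∃ v₀ : K →+* ℝ, ∀ v : K →+* ℝ, v ≠ v₀ → v ((u : 𝓞 K) : K) ≤ 1 / 2 := by
  obtain ⟨φ⟩ : Nonempty (K →+* ℂ) := inferInstance
  let v₀ : K →+* ℝ := (htotreal φ).embedding
  have hinj := mk_ofReal_comp_injective K
  have : Finite (K →+* ℝ) := Finite.of_injective _ hinj
  obtain ⟨ε, hε⟩ := Units.dirichletUnitTheorem.exists_unit K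
    (InfinitePlace.mk (Complex.ofRealHom.comp v₀))
  have hlt : ∀ v : K →+* ℝ, v ≠ v₀ → v ((ε : 𝓞 K) : K) ^ 2 < 1 := by
    intro v hv
    have h := hε (InfinitePlace.mk (Complex.ofRealHom.comp v)) (hinj.ne hv)
    rw [← Real.log_one, Real.log_lt_log_iff (Units.pos_at_place _ _) one_pos] at h
    rw [sq_lt_one_iff_abs_lt_one]
    simpa [InfinitePlace.apply] using h
  have hev : ∀ᶠ k : ℕ in Filter.atTop, ∀ v : K →+* ℝ, v ≠ v₀ →
      (v ((ε : 𝓞 K) : K) ^ 2) ^ k ≤ 1 / 2 := by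
    refine Filter.eventually_all.mpr fun v ↦ Filter.eventually_imp_distrib_left.mpr fun hv ↦ ?_
    exact (tendsto_pow_atTop_nhds_zero_of_lt_one (sq_nonneg _) (hlt v hv)).eventually_le_const
      one_half_pos
  obtain ⟨k, hk⟩ := hev.exists
  refine ⟨(ε ^ 2) ^ k, fun v ↦ ?_, v₀, fun v hv ↦ ?_⟩
  · have hne : v ((ε : 𝓞 K) : K) ≠ 0 := (map_ne_zero v).mpr (Units.coe_ne_zero ε)
    simp only [Units.val_pow_eq_pow_val, map_pow]
    positivity
  · simpa only [Units.val_pow_eq_pow_val, map_pow] using hk v hv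
end

section
/- Let n be an odd prime such that 2 is a primitive root modulo n (i.e. 2 generates the multiplicative group (ℤ/nℤ)^×). Let K/ℚ be a totally real Galois extension of degree n with ring of integers 𝓞 and unit group 𝒰 = 𝓞^×. If 𝒰 contains a unit that is neither totally positive nor totally negative (i.e. a unit u with v(u) > 0 for some real embedding v and w(u) < 0 for some other real embedding w), then every totally positive unit of 𝓞 is the square of a unit. -/
set_option synthInstance.maxHeartbeats 1000000
set_option maxHeartbeats 2000000

open NumberField

open Polynomial in
/-- If `2` is a primitive root modulo a prime `n ≠ 2`, then the `n`-th cyclotomic polynomial is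
irreducible over `ZMod 2`. -/
theorem irreducible_cyclotomic_zmod_two {n : ℕ} (hn : n.Prime) (hn2 : n ≠ 2)
    (h : orderOf (2 : ZMod n) = n - 1) : Irreducible (cyclotomic n (ZMod 2)) := by
  have : Fact (Nat.Prime 2) := ⟨Nat.prime_two⟩
  have hndvd : ¬ 2 ∣ n := fun hd => hn2 ((Nat.prime_dvd_prime_iff_eq Nat.prime_two hn).1 hd).symm
  refine ZMod.irreducible_of_dvd_cyclotomic_of_natDegree hndvd dvd_rfl ?_
  rw [natDegree_cyclotomic, Nat.totient_prime hn, ← h, ← orderOf_units, ZMod.coe_unitOfCoprime]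
  norm_cast

section Shift

variable {G : Type*} [Group G]

/-- Right translation by `σ` on functions from a group to `ZMod 2`. -/
def rightShift (σ : G) : Module.End (ZMod 2) (G → ZMod 2) :=
  LinearMap.funLeft (ZMod 2) (ZMod 2) (fun g => g * σ)

theorem rightShift_pow_apply (σ : G) (k : ℕ) (f : G → ZMod 2) (g : G) :
    (rightShift σ ^ k) f g = f (g * σ ^ k) := by
  induction k generalizing g with
  | zero => simp
  | succ k ih =>
    rw [pow_succ', Module.End.mul_apply]
    change (rightShift σ ^ k) f (g * σ) = _
    rw [ih, pow_succ', mul_assoc]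

variable [Fintype G]

theorem exists_pow_eq_of_prime_card {n : ℕ} (hn : n.Prime) {σ : G} (hσ : orderOf σ = n)
    (hcard : Fintype.card G = n) (g : G) : ∃ k < n, σ ^ k = g := by
  classical
  have := mem_zpowers_of_prime_card (p := n) (g := σ) (g' := g) (hp := ⟨hn⟩) (by simpa using hcard)
    (by rintro rfl; simp at hσ; exact hn.one_lt.ne hσ)
  rw [← mem_powers_iff_mem_zpowers, mem_powers_iff_mem_range_orderOf, hσ] at this
  simpa using this

open Polynomial in
theorem aeval_rightShift_cyclotomic_apply {n : ℕ} (hn : n.Prime) {σ : G} (hσ : orderOf σ = n)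
    (hcard : Fintype.card G = n) (f : G → ZMod 2) (g : G) :
    aeval (rightShift σ) (cyclotomic n (ZMod 2)) f g = ∑ x, f x := by
  have : Fact n.Prime := ⟨hn⟩
  rw [cyclotomic_prime, map_sum, LinearMap.sum_apply, Finset.sum_apply]
  simp only [map_pow, aeval_X, rightShift_pow_apply]
  refine Finset.sum_bij (fun k _ => g * σ ^ k) (by simp) ?_ ?_ (by simp)
  · intro a ha b hb hab
    exact pow_injOn_Iio_orderOf (by simpa [hσ] using ha) (by simpa [hσ] using hb)
      (mul_left_cancel hab)
  · intro x _
    obtain ⟨k, hk, hx⟩ := exists_pow_eq_of_prime_card hn hσ hcard (g⁻¹ * x)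
    exact ⟨k, by simpa using hk, by simp [hx]⟩

open Polynomial in
/-- Over `ZMod 2`, a shift-invariant subspace of functions on a cyclic group of odd prime order
`n`, for which `2` is a primitive root, is everything as soon as it contains the constants and a
nonconstant function. -/
theorem eq_top_of_rightShift_invariant {n : ℕ} (hn : n.Prime) (hn2 : n ≠ 2)
    (h2 : orderOf (2 : ZMod n) = n - 1) {σ : G} (hσ : orderOf σ = n) (hcard : Fintype.card G = n)
    (I : Submodule (ZMod 2) (G → ZMod 2)) (hI : I ≤ I.comap (rightShift σ)) (hone : 1 ∈ I)
    {f : G → ZMod 2} (hf : f ∈ I) {a b : G} (hab : f a ≠ f b) : I = ⊤ := by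
  classical
  let e : G → ZMod 2 := Pi.single 1 1
  let ev : (ZMod 2)[X] →ₗ[ZMod 2] (G → ZMod 2) :=
    (LinearMap.applyₗ e).comp (aeval (rightShift σ)).toLinearMap
  have hev (p : (ZMod 2)[X]) : ev p = aeval (rightShift σ) p e := rfl
  have hsingle (g : G) : ∃ k : ℕ, (rightShift σ ^ k) e = Pi.single g 1 := by
    obtain ⟨k, -, hk⟩ := exists_pow_eq_of_prime_card hn hσ hcard g⁻¹
    refine ⟨k, funext fun x => ?_⟩
    simp [rightShift_pow_apply, hk, e, Pi.single_apply, mul_inv_eq_one]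
  have htop (J : Submodule (ZMod 2) (G → ZMod 2)) (hJ : ∀ k : ℕ, (rightShift σ ^ k) e ∈ J) :
      J = ⊤ := by
    rw [eq_top_iff, ← (Pi.basisFun (ZMod 2) G).span_eq, Submodule.span_le]
    rintro _ ⟨g, rfl⟩
    obtain ⟨k, hk⟩ := hsingle g
    simpa [← hk] using hJ k
  have hsurj : LinearMap.range ev = ⊤ := htop _ fun k => ⟨X ^ k, by simp [hev]⟩
  have haeval (p : (ZMod 2)[X]) {x : G → ZMod 2} (hx : x ∈ I) : aeval (rightShift σ) p x ∈ I :=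
    aeval_apply_smul_mem_of_le_comap hx p _ hI
  let J : Ideal (ZMod 2)[X] :=
    { I.comap ev with
      smul_mem' := fun p q hq => by
        change aeval (rightShift σ) (p * q) e ∈ I
        rw [map_mul]
        exact haeval p hq }
  have hJ (p : (ZMod 2)[X]) : p ∈ J ↔ aeval (rightShift σ) p e ∈ I := Iff.rfl
  have hmax : (Ideal.span {cyclotomic n (ZMod 2)}).IsMaximal :=
    PrincipalIdealRing.isMaximal_of_irreducible (irreducible_cyclotomic_zmod_two hn hn2 h2)
  have hle : Ideal.span {cyclotomic n (ZMod 2)} ≤ J := by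
    rw [Ideal.span_singleton_le_iff_mem, hJ]
    convert hone
    ext g
    simp [aeval_rightShift_cyclotomic_apply hn hσ hcard, e]
  have hJtop : J = ⊤ := by
    rcases (Ideal.isMaximal_def.1 hmax).le_iff.1 hle with h | h
    · exact h
    · exfalso
      obtain ⟨p, hp⟩ := LinearMap.range_eq_top.1 hsurj f
      have hpJ : p ∈ J := by rw [hJ, ← hev, hp]; exact hf
      rw [h, Ideal.mem_span_singleton] at hpJ
      obtain ⟨q, rfl⟩ := hpJ
      apply hab
      rw [← hp, hev, map_mul, Module.End.mul_apply,
        aeval_rightShift_cyclotomic_apply hn hσ hcard,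
        aeval_rightShift_cyclotomic_apply hn hσ hcard]
  have he : e ∈ I := by simpa [hJ] using (Ideal.eq_top_iff_one J).1 hJtop
  refine htop I fun k => ?_
  simpa using haeval (X ^ k) he

end Shift

/-- The sign of a real number, written additively: `1` for negative numbers, `0` otherwise. -/
noncomputable def negIndicator (x : ℝ) : ZMod 2 := if x < 0 then 1 else 0

theorem negIndicator_mul {x y : ℝ} (hx : x ≠ 0) (hy : y ≠ 0) :
    negIndicator (x * y) = negIndicator x + negIndicator y := by
  unfold negIndicator
  rcases hx.lt_or_gt with hx | hx <;> rcases hy.lt_or_gt with hy | hy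
  · simp only [(mul_pos_of_neg_of_neg hx hy).not_gt, hx, hy, if_true, if_false]; decide
  · simp [mul_neg_of_neg_of_pos hx hy, hx, hy.not_gt]
  · simp [mul_neg_of_pos_of_neg hx hy, hy, hx.not_gt]
  · simp [(mul_pos hx hy).not_gt, hy.not_gt, hx.not_gt]

section Signature

variable {K : Type*} [Field K] [NumberField K]

/-- The signs of a unit under the conjugates of a real embedding. -/
noncomputable def unitSignature (v : K →+* ℝ) :
    Additive (𝓞 K)ˣ →+ (Gal(K/ℚ) → ZMod 2) where
  toFun u g := negIndicator (v (g ((u.toMul : 𝓞 K) : K)))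
  map_zero' := by ext; simp [negIndicator, not_lt.2 zero_le_one]
  map_add' x y := by
    ext g
    simp only [toMul_add, Units.val_mul, map_mul, Pi.add_apply]
    exact negIndicator_mul (by simp) (by simp)

theorem unitSignature_apply (v : K →+* ℝ) (u : (𝓞 K)ˣ) (g : Gal(K/ℚ)) :
    unitSignature v (.ofMul u) g = negIndicator (v (g ((u : 𝓞 K) : K))) := rfl

theorem exists_real_embedding_eq_comp [IsGalois ℚ K] (v w : K →+* ℝ) :
    ∃ g : Gal(K/ℚ), ∀ x, w x = v (g x) := by
  obtain ⟨g, hg⟩ := ComplexEmbedding.exists_comp_symm_eq_of_comp_eq (k := ℚ)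
    (Complex.ofRealHom.comp v) (Complex.ofRealHom.comp w) (by ext; simp)
  refine ⟨g.symm, fun x => ?_⟩
  have := RingHom.congr_fun hg x
  simpa using this.symm

/-- In odd degree, every unit is, up to squares, a product of a subset of `-1` and the fundamental
units. -/
theorem exists_unit_eq_sq_mul (hodd : Odd (Module.finrank ℚ K)) (u : (𝓞 K)ˣ) :
    ∃ (w : (𝓞 K)ˣ) (c : Fin 2 × (Fin (Units.rank K) → Fin 2)),
      u = w ^ 2 * ((-1) ^ (c.1 : ℕ) * ∏ i, Units.fundSystem K i ^ (c.2 i : ℕ)) := by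
  obtain ⟨⟨ζ, m⟩, hu, -⟩ := Units.exist_unique_eq_mul_prod K u
  have hζ : ∃ j : Fin 2, (ζ : (𝓞 K)ˣ) = (-1) ^ (j : ℕ) := by
    rcases Units.torsion_eq_one_or_neg_one_of_odd_finrank hodd ζ with h | h
    · exact ⟨0, by simp [h]⟩
    · exact ⟨1, by simp [h]⟩
  obtain ⟨j, hj⟩ := hζ
  have hm (k : ℤ) : ∃ (r : Fin 2) (q : ℤ), k = q * 2 + (r : ℕ) := by
    rcases Int.even_or_odd' k with ⟨q, h | h⟩
    · exact ⟨0, q, by simp; omega⟩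
    · exact ⟨1, q, by simp; omega⟩
  choose r q hrq using hm
  refine ⟨∏ i, Units.fundSystem K i ^ q (m i), ⟨j, fun i => r (m i)⟩, ?_⟩
  rw [hu, hj, mul_left_comm, ← Finset.prod_pow, ← Finset.prod_mul_distrib]
  congr 1
  refine Finset.prod_congr rfl fun i _ => ?_
  dsimp only
  conv_lhs => rw [hrq (m i)]
  rw [zpow_add, zpow_mul, zpow_natCast]
  norm_cast

/-- If every signature is attained by a unit of a totally real field of odd degree, then units with
trivial signature are squares. -/
theorem exists_eq_sq_of_unitSignature_surjective [IsGalois ℚ K] [IsTotallyReal K]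
    (hodd : Odd (Module.finrank ℚ K)) {v : K →+* ℝ} (hv : Function.Surjective (unitSignature v))
    {u : (𝓞 K)ˣ} (hu : unitSignature v (.ofMul u) = 0) : ∃ w : (𝓞 K)ˣ, u = w ^ 2 := by
  let P := Fin 2 × (Fin (Units.rank K) → Fin 2)
  let F : P → (𝓞 K)ˣ := fun c => (-1) ^ (c.1 : ℕ) * ∏ i, Units.fundSystem K i ^ (c.2 i : ℕ)
  have hsq (w x : (𝓞 K)ˣ) :
      unitSignature v (.ofMul (w ^ 2 * x)) = unitSignature v (.ofMul x) := by
    rw [ofMul_mul, ofMul_pow, map_add, map_nsmul, two_nsmul]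
    ext g
    simp [CharTwo.add_self_eq_zero]
  have hsurj : Function.Surjective fun c : P => unitSignature v (.ofMul (F c)) := by
    intro s
    obtain ⟨x, hx⟩ := hv s
    obtain ⟨w, c, hc⟩ := exists_unit_eq_sq_mul hodd x.toMul
    refine ⟨c, ?_⟩
    rw [← hx, ← ofMul_toMul x, hc, hsq]
  have hcard : Nat.card P = Nat.card (Gal(K/ℚ) → ZMod 2) := by
    have h1 : Nat.card (Gal(K/ℚ)) = Module.finrank ℚ K := IsGalois.card_aut_eq_finrank ℚ K
    have h2 : Fintype.card (InfinitePlace K) = Module.finrank ℚ K := by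
      rw [IsTotallyReal.finrank, InfinitePlace.card_eq_nrRealPlaces_add_nrComplexPlaces,
        IsTotallyReal.nrComplexPlaces_eq_zero, add_zero]
    have h3 : Units.rank K + 1 = Module.finrank ℚ K := by
      rw [Units.rank, h2, Nat.sub_add_cancel Module.finrank_pos]
    rw [Nat.card_prod, Nat.card_fun, Nat.card_fun, h1, ← h3]
    simp [pow_succ']
  have hinj := ((Nat.bijective_iff_surjective_and_card _).2 ⟨hsurj, hcard⟩).1
  obtain ⟨w, c, hc⟩ := exists_unit_eq_sq_mul hodd u
  have hc0 : c = (0 : P) := hinj <| by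
    change unitSignature v (.ofMul (F c)) = unitSignature v (.ofMul (F 0))
    rw [← hsq w, ← hc, hu]
    simp [F]
  exact ⟨w, by simpa [hc0] using hc⟩

theorem rightShift_unitSignature (v : K →+* ℝ) (σ : Gal(K/ℚ)) (u : (𝓞 K)ˣ) :
    rightShift σ (unitSignature v (.ofMul u)) =
      unitSignature v (.ofMul (Units.map (RingOfIntegers.mapRingHom σ).toMonoidHom u)) := rfl

end Signature

/-- **Lemma 2.9** (Friedlander–Iwaniec–Mazur–Rubin, "The spin of prime ideals").
Suppose `n` is an odd prime and `2` is a primitive root modulo `n`.  If `K/ℚ` is a totally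
real Galois extension of degree `n` whose unit group contains a unit that is neither
totally positive nor totally negative, then every totally positive unit of `𝓞 K` is the
square of a unit. -/
theorem spins_of_prime_ideals_stmt18
    (n : ℕ) (hnp : n.Prime) (hnodd : Odd n)
    (hprimroot : orderOf (2 : ZMod n) = n - 1)
    (K : Type*) [Field K] [NumberField K] [IsGalois ℚ K]
    (hdeg : Module.finrank ℚ K = n)
    (htotreal : ∀ φ : K →+* ℂ, ComplexEmbedding.IsReal φ)
    (hmixed : ∃ u : (𝓞 K)ˣ, (∃ v : K →+* ℝ, 0 < v ((u : 𝓞 K) : K)) ∧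
      (∃ w : K →+* ℝ, w ((u : 𝓞 K) : K) < 0)) :
    ∀ u : (𝓞 K)ˣ, (∀ v : K →+* ℝ, 0 < v ((u : 𝓞 K) : K)) →
      ∃ w : (𝓞 K)ˣ, u = w ^ 2 := by
  have hn2 : n ≠ 2 := by rintro rfl; exact absurd hnodd (by decide)
  have : IsTotallyReal K := ⟨fun w => by
    rw [← InfinitePlace.mk_embedding w, InfinitePlace.isReal_mk_iff]
    exact htotreal _⟩
  intro u hu
  obtain ⟨x, ⟨v, hv⟩, w, hw⟩ := hmixed
  have hcard : Nat.card Gal(K/ℚ) = n := hdeg ▸ IsGalois.card_aut_eq_finrank ℚ K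
  obtain ⟨σ, hσ⟩ := exists_prime_orderOf_dvd_card' (G := Gal(K/ℚ)) (hp := ⟨hnp⟩) n
    (dvd_of_eq hcard.symm)
  obtain ⟨g, hg⟩ := exists_real_embedding_eq_comp v w
  let I : Submodule (ZMod 2) (Gal(K/ℚ) → ZMod 2) :=
    AddSubgroup.toZModSubmodule 2 (unitSignature v).range
  have hI : I = ⊤ := by
    refine eq_top_of_rightShift_invariant hnp hn2 hprimroot hσ (by simpa using hcard) I ?_ ?_
      (f := unitSignature v (.ofMul x)) ⟨_, rfl⟩ (a := 1) (b := g) ?_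
    · rintro _ ⟨y, rfl⟩
      exact ⟨_, (rightShift_unitSignature v σ y.toMul).symm⟩
    · exact ⟨.ofMul (-1), by ext; simp [unitSignature_apply, negIndicator]⟩
    · rw [hg] at hw
      simp [unitSignature_apply, negIndicator, hv.not_gt, hw]
  refine exists_eq_sq_of_unitSignature_surjective (hdeg ▸ hnodd) (v := v) (fun s => ?_) ?_
  · exact (show s ∈ I from hI ▸ Submodule.mem_top)
  · ext g
    have hpos : 0 < v (g ((u : 𝓞 K) : K)) := hu (v.comp (g : K →+* K))
    simp [unitSignature_apply, negIndicator, hpos.le]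
end
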